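/- Let p be a prime and let N(0) denote the number of 0s in a period of the sequence (s_n). Then N(0) = ((1 - φ(p-1)/p)/(2 - φ(p-1)/p) + o(1))·T as p → ∞ through the primes; that is, for every ε > 0 there exists P such that for all primes p ≥ P, |N(0) - T·(1 - φ(p-1)/p)/(2 - φ(p-1)/p)| ≤ ε·T. -/

import Mathlib

/-- The primitive roots modulo `p` in increasing order: `g_1 < g_2 < … < g_{φ(p-1)}`
(0-indexed as a sorted list). -/
noncomputable def primRootsList (p : ℕ) : List ℕ :=
  ((Finset.Ico 1 p).filter fun g : ℕ => orderOf ((g : ZMod p)) = p - 1).sort (· ≤ ·)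

/-- The binary sequence `s_n ≡ g_{n+1} + g_{n+2} (mod 2)` of period `T = φ(p-1) - 1`,
extended `T`-periodically. -/
noncomputable def seqS (p n : ℕ) : ℕ :=
  ((primRootsList p).getD (n % (Nat.totient (p - 1) - 1)) 0 +
    (primRootsList p).getD (n % (Nat.totient (p - 1) - 1) + 1) 0) % 2

section

open Polynomial

theorem linearIndependent_radicals {K L β : Type*} [Field K] [Field L] [Algebra K L]
    [IsGalois K L] {D : ℕ} (z : β → L) (hz : ∀ b, z b ≠ 0)
    (hroot : ∀ u : L, u ^ D = 1 → u ∈ Set.range (algebraMap K L))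
    (hzD : ∀ b, z b ^ D ∈ Set.range (algebraMap K L))
    (hne : ∀ b b', z b / z b' ∈ Set.range (algebraMap K L) → b = b') :
    LinearIndependent K z := by
  have hfix : ∀ (σ τ : L ≃ₐ[K] L) b, σ (τ (z b) / z b) = τ (z b) / z b := by
    intro σ τ b
    obtain ⟨w, hw⟩ := hzD b
    obtain ⟨v, hv⟩ := hroot (τ (z b) / z b) (by
      rw [div_pow, ← map_pow, ← hw, AlgEquiv.commutes, div_self]
      rw [hw]; exact pow_ne_zero _ (hz b))
    rw [← hv, AlgEquiv.commutes]
  let χ : β → ((L ≃ₐ[K] L) →* L) := fun b =>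
    { toFun := fun σ => σ (z b) / z b
      map_one' := by simp [hz b]
      map_mul' := fun σ τ => by
        have h := hfix σ τ b
        rw [map_div₀] at h
        have h1 : σ (z b) ≠ 0 := by simpa using hz b
        have h2 := hz b
        rw [AlgEquiv.mul_apply]
        rw [div_eq_div_iff h1 h2] at h
        field_simp
        linear_combination h }
  have hχ : Function.Injective χ := by
    intro b b' h
    apply hne
    rw [InfiniteGalois.mem_range_algebraMap_iff_fixed]
    intro σ
    have h1 : σ (z b) / z b = σ (z b') / z b' := DFunLike.congr_fun h σ
    have h2 : σ (z b') ≠ 0 := by simpa using hz b'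
    rw [map_div₀, div_eq_div_iff h2 (hz b')]
    rw [div_eq_div_iff (hz b) (hz b')] at h1
    linear_combination h1
  have hli := (linearIndependent_monoidHom (L ≃ₐ[K] L) L).comp χ hχ
  rw [linearIndependent_iff'] at hli ⊢
  intro s g hg b hb
  have := hli s (fun b => algebraMap K L (g b) * z b) (by
    ext σ
    have h := congrArg σ hg
    simp only [map_sum, map_zero, map_smul] at h
    simp only [Function.comp_apply, Finset.sum_apply, Pi.smul_apply, Pi.zero_apply, smul_eq_mul]
    rw [← h]
    refine Finset.sum_congr rfl fun b _ => ?_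
    change algebraMap K L (g b) * z b * (σ (z b) / z b) = _
    rw [Algebra.smul_def]
    field_simp [hz b]) b hb
  simpa [hz b] using this

theorem ZMod.mem_range_of_pow_eq_one {p D : ℕ} [Fact p.Prime] (hD : D ∣ p - 1) {L : Type*}
    [Field L] (φ : ZMod p →+* L) (u : L) (hu : u ^ D = 1) : u ∈ Set.range φ := by
  have h1 : u ^ p = u := by
    obtain ⟨M, hM⟩ := hD
    have hp := (Fact.out : p.Prime).pos
    rw [show p = D * M + 1 by omega, pow_succ, pow_mul, hu, one_pow, one_mul]
  have : CharP L p := charP_of_injective_ringHom φ.injective p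
  have h2 := (Subfield.mem_bot_iff_pow_eq_self L p).2 h1
  exact (bot_le : (⊥ : Subfield L) ≤ φ.fieldRange) h2

/-- The natural map from polynomials over `F` to an extension of `F(X)`. -/
noncomputable def polyToExt (F L : Type*) [Field F] [Field L] [Algebra (RatFunc F) L] :
    F[X] →+* L :=
  (algebraMap (RatFunc F) L).comp (algebraMap F[X] (RatFunc F))

theorem polyToExt_injective (F L : Type*) [Field F] [Field L] [Algebra (RatFunc F) L] :
    Function.Injective (polyToExt F L) :=
  (algebraMap (RatFunc F) L).injective.comp (IsFractionRing.injective F[X] (RatFunc F))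

theorem linearIndependent_root_monomials {p D : ℕ} [Fact p.Prime] (hD : D ∣ p - 1)
    {ι : Type*} [Fintype ι] {α : ι → ZMod p} (hα : Function.Injective α)
    {L : Type*} [Field L] [Algebra (RatFunc (ZMod p)) L] [IsGalois (RatFunc (ZMod p)) L]
    {c : ι → ZMod p} (hc : ∀ l, c l ≠ 0) (y : ι → L)
    (hy : ∀ l, polyToExt (ZMod p) L (X - C (α l)) * y l ^ D = polyToExt (ZMod p) L (C (c l))) :
    LinearIndependent (RatFunc (ZMod p)) fun b : ι → Fin D => ∏ l, y l ^ (b l : ℕ) := by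
  set φ := polyToExt (ZMod p) L with hφ
  have hinj : Function.Injective φ := polyToExt_injective _ _
  have hX : ∀ l, φ (X - C (α l)) ≠ 0 := fun l => by
    rw [Ne, map_eq_zero_iff _ hinj]; exact X_sub_C_ne_zero _
  have hC : ∀ l, φ (C (c l)) ≠ 0 := fun l => by
    rw [Ne, map_eq_zero_iff _ hinj]; simpa using hc l
  have hDpos : ∀ b : ι → Fin D, ∀ l, D ≠ 0 := fun b l => by have := (b l).2; omega
  have hyD : ∀ l, y l ^ D = φ (C (c l)) / φ (X - C (α l)) := fun l => by
    rw [eq_div_iff (hX l), mul_comm, hy]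
  have hy0 : ∀ (b : ι → Fin D), ∏ l, y l ^ (b l : ℕ) ≠ 0 := fun b => by
    refine Finset.prod_ne_zero_iff.2 fun l _ => pow_ne_zero _ fun h0 => ?_
    have := hy l
    rw [h0, zero_pow (hDpos b l), mul_zero] at this
    exact hC l this.symm
  have hpow : ∀ b : ι → Fin D, (∏ l, y l ^ (b l : ℕ)) ^ D
      = φ (∏ l, C (c l) ^ (b l : ℕ)) / φ (∏ l, (X - C (α l)) ^ (b l : ℕ)) := by
    intro b
    rw [map_prod, map_prod, ← Finset.prod_div_distrib, ← Finset.prod_pow]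
    refine Finset.prod_congr rfl fun l _ => ?_
    rw [← pow_mul, mul_comm, pow_mul, hyD, div_pow, map_pow, map_pow]
  refine linearIndependent_radicals (D := D) _ hy0 ?_ ?_ ?_
  · intro u hu
    obtain ⟨a, rfl⟩ := ZMod.mem_range_of_pow_eq_one hD (φ.comp C) u hu
    exact ⟨_, rfl⟩
  · intro b
    rw [hpow]
    exact ⟨algebraMap _ _ (∏ l, C (c l) ^ (b l : ℕ)) /
      algebraMap _ _ (∏ l, (X - C (α l)) ^ (b l : ℕ)), by rw [map_div₀]; rfl⟩
  · rintro b b' ⟨w, hw⟩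
    obtain ⟨u, v, hv, rfl⟩ := IsFractionRing.div_surjective (A := (ZMod p)[X]) w
    have hv0 : v ≠ 0 := nonZeroDivisors.ne_zero hv
    have huv : φ u / φ v = (∏ l, y l ^ (b l : ℕ)) / ∏ l, y l ^ (b' l : ℕ) := by
      rw [← hw, map_div₀]; rfl
    have hφv : φ v ≠ 0 := by rwa [Ne, map_eq_zero_iff _ hinj]
    have hu0 : u ≠ 0 := by
      rintro rfl
      rw [map_zero, zero_div, eq_comm, div_eq_zero_iff] at huv
      exact huv.elim (hy0 b) (hy0 b')
    have hP : ∀ b : ι → Fin D, ∏ l, (X - C (α l)) ^ (b l : ℕ) ≠ 0 := fun b =>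
      Finset.prod_ne_zero_iff.2 fun l _ => pow_ne_zero _ (X_sub_C_ne_zero _)
    have hQ : ∀ b : ι → Fin D, ∏ l, C (c l) ^ (b l : ℕ) ≠ 0 := fun b =>
      Finset.prod_ne_zero_iff.2 fun l _ => pow_ne_zero _ (by simpa using hc l)
    have hφP : ∀ b : ι → Fin D, φ (∏ l, (X - C (α l)) ^ (b l : ℕ)) ≠ 0 := fun b => by
      rw [Ne, map_eq_zero_iff _ hinj]; exact hP b
    have hφQ : ∀ b : ι → Fin D, φ (∏ l, C (c l) ^ (b l : ℕ)) ≠ 0 := fun b => by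
      rw [Ne, map_eq_zero_iff _ hinj]; exact hQ b
    have key := congrArg (· ^ D) huv
    simp only [div_pow, hpow] at key
    rw [div_div_div_eq, div_eq_div_iff (pow_ne_zero _ hφv) (mul_ne_zero (hφP b) (hφQ b'))] at key
    simp only [← map_pow, ← map_mul] at key
    replace key := hinj key
    simp only [C_pow] at key
    funext i
    have hrm : ∀ b : ι → Fin D,
        rootMultiplicity (α i) (∏ l, (X - C (α l)) ^ (b l : ℕ)) = b i := by
      intro b
      classical
      rw [← Finset.mul_prod_erase _ _ (Finset.mem_univ i), mul_comm,
        rootMultiplicity_mul_X_sub_C_pow, rootMultiplicity_eq_zero, zero_add]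
      · rw [IsRoot, eval_prod, ← Ne, Finset.prod_ne_zero_iff]
        intro l hl
        rw [eval_pow, eval_sub, eval_X, eval_C]
        exact pow_ne_zero _ (sub_ne_zero.2 fun h => (Finset.ne_of_mem_erase hl) (hα h).symm)
      · exact Finset.prod_ne_zero_iff.2 fun l _ => pow_ne_zero _ (X_sub_C_ne_zero _)
    have hcst : ∀ b : ι → Fin D, rootMultiplicity (α i) (∏ l, C (c l) ^ (b l : ℕ)) = 0 := by
      intro b
      simp only [← C_pow, ← map_prod, rootMultiplicity_C]
    have hm := congrArg (rootMultiplicity (α i)) key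
    have hpw : ∀ f : (ZMod p)[X], rootMultiplicity (α i) (f ^ D) = D * rootMultiplicity (α i) f :=
      fun f => by rw [← count_roots, ← count_roots, roots_pow, Multiset.count_nsmul]
    rw [rootMultiplicity_mul (mul_ne_zero (pow_ne_zero _ hu0) (mul_ne_zero (hP b) (hQ b'))),
      rootMultiplicity_mul (mul_ne_zero (hP b) (hQ b')),
      rootMultiplicity_mul (mul_ne_zero (mul_ne_zero (hQ b) (hP b')) (pow_ne_zero _ hv0)),
      rootMultiplicity_mul (mul_ne_zero (hQ b) (hP b')), hrm, hrm, hcst, hcst, hpw, hpw] at hm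
    have := congrArg (· % D) hm
    simp only [add_zero, zero_add, Nat.mul_add_mod, Nat.add_mul_mod_self_left] at this
    rwa [Nat.mod_eq_of_lt (b i).2, Nat.mod_eq_of_lt (b' i).2, ← Fin.ext_iff] at this

/-- The coefficient of `y ^ (b + b' mod D)` in `∏ (X - α) * y ^ b * y ^ b'`, where
`(X - α) * y ^ D = c`. -/
noncomputable def carryPoly {F ι : Type*} [Field F] [Fintype ι] {D : ℕ} (α c : ι → F)
    (b b' : ι → Fin D) : F[X] :=
  ∏ l, if (b l : ℕ) + b' l < D then X - C (α l) else C (c l)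

theorem map_carryPoly_mul {F ι R : Type*} [Field F] [Fintype ι] [CommRing R] {D : ℕ} [NeZero D]
    (α c : ι → F) (φ : F[X] →+* R) (y : ι → R)
    (hy : ∀ l, φ (X - C (α l)) * y l ^ D = φ (C (c l))) (b b' : ι → Fin D) :
    φ (carryPoly α c b b') * ∏ l, y l ^ ((b + b') l : ℕ)
      = φ (∏ l, (X - C (α l))) * ((∏ l, y l ^ (b l : ℕ)) * ∏ l, y l ^ (b' l : ℕ)) := by
  rw [carryPoly, map_prod, map_prod, ← Finset.prod_mul_distrib, ← Finset.prod_mul_distrib,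
    ← Finset.prod_mul_distrib]
  refine Finset.prod_congr rfl fun l _ => ?_
  rw [Pi.add_apply, Fin.val_add, ← pow_add]
  split_ifs with h
  · rw [Nat.mod_eq_of_lt h]
  · have h1 := (b l).2
    have h2 := (b' l).2
    rw [← hy, Nat.mod_eq_sub_mod (not_lt.1 h), Nat.mod_eq_of_lt (by omega), mul_assoc, ← pow_add,
      Nat.add_sub_cancel' (not_lt.1 h)]

/-- The matrix of multiplication by `∏ (X - α) * ∑ P b * y ^ b` in the basis of monomials
`y ^ b`, where `(X - α) * y ^ D = c`. -/
noncomputable def mulMatrix {F ι : Type*} [Field F] [Fintype ι] {D : ℕ} [NeZero D] (α c : ι → F)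
    (P : (ι → Fin D) → F[X]) : Matrix (ι → Fin D) (ι → Fin D) F[X] :=
  fun e b' => carryPoly α c (e - b') b' * P (e - b')

theorem sum_map_mulMatrix {F ι R : Type*} [Field F] [Fintype ι] [DecidableEq ι] [CommRing R]
    {D : ℕ} [NeZero D]
    (α c : ι → F) (φ : F[X] →+* R) (y : ι → R)
    (hy : ∀ l, φ (X - C (α l)) * y l ^ D = φ (C (c l))) (P : (ι → Fin D) → F[X])
    (b' : ι → Fin D) :
    ∑ e, (∏ l, y l ^ (e l : ℕ)) * φ (mulMatrix α c P e b')
      = φ (∏ l, (X - C (α l))) * (∑ b, φ (P b) * ∏ l, y l ^ (b l : ℕ)) *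
        ∏ l, y l ^ (b' l : ℕ) := by
  rw [← Equiv.sum_comp (Equiv.addRight b'), Finset.mul_sum, Finset.sum_mul]
  refine Finset.sum_congr rfl fun b _ => ?_
  have := map_carryPoly_mul α c φ y hy b b'
  simp only [mulMatrix, Equiv.coe_addRight, add_sub_cancel_right, map_mul]
  linear_combination φ (P b) * this

theorem natDegree_carryPoly_le {F ι : Type*} [Field F] [Fintype ι] {D : ℕ} (α c : ι → F)
    (b b' : ι → Fin D) : (carryPoly α c b b').natDegree ≤ Fintype.card ι := by
  refine (natDegree_prod_le _ _).trans ((Finset.sum_le_card_nsmul _ _ 1 fun l _ => ?_).trans ?_)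
  · split_ifs
    · rw [natDegree_X_sub_C]
    · rw [natDegree_C]; exact zero_le_one
  · simp

theorem natDegree_det_le {F n : Type*} [Field F] [Fintype n] [DecidableEq n]
    (W : Matrix n n F[X]) {d : ℕ} (h : ∀ i j, (W i j).natDegree ≤ d) :
    W.det.natDegree ≤ Fintype.card n * d := by
  rw [Matrix.det_apply]
  refine natDegree_sum_le_of_forall_le _ _ fun σ _ => (natDegree_smul_le _ _).trans
    ((natDegree_prod_le _ _).trans ((Finset.sum_le_card_nsmul _ _ d fun i _ => h _ _).trans ?_))
  simp

theorem eq_zero_of_sum_root_monomials {p D : ℕ} [Fact p.Prime] (hD : D ∣ p - 1)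
    {ι : Type*} [Fintype ι] [DecidableEq ι] {α : ι → ZMod p} (hα : Function.Injective α)
    {L : Type*} [Field L] [Algebra (RatFunc (ZMod p)) L] [IsGalois (RatFunc (ZMod p)) L]
    {c : ι → ZMod p} (hc : ∀ l, c l ≠ 0) (y : ι → L)
    (hy : ∀ l, polyToExt (ZMod p) L (X - C (α l)) * y l ^ D = polyToExt (ZMod p) L (C (c l)))
    (P : (ι → Fin D) → (ZMod p)[X])
    (h : ∑ b, polyToExt (ZMod p) L (P b) * ∏ l, y l ^ (b l : ℕ) = 0) : P = 0 := by
  classical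
  have := Fintype.linearIndependent_iff.1 (linearIndependent_root_monomials hD hα hc y hy)
    (fun b => algebraMap _ _ (P b)) (by
      rw [← h]
      exact Finset.sum_congr rfl fun b _ => Algebra.smul_def _ _)
  funext b
  exact IsFractionRing.injective (ZMod p)[X] (RatFunc (ZMod p)) (by simpa using this b)

theorem eq_zero_of_X_sub_C_pow_dvd {p D M : ℕ} [Fact p.Prime] (hD : M * D = p - 1)
    {ι : Type*} [Fintype ι] [DecidableEq ι] {α : ι → ZMod p} (hα : Function.Injective α)
    {β : ZMod p} (hβ : ∀ l, β ≠ α l) {A : ℕ} (hA : D ^ Fintype.card ι * (A + Fintype.card ι) < p)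
    (P : (ι → Fin D) → (ZMod p)[X]) (hP : ∀ b, (P b).natDegree ≤ A)
    (h : (X - C β) ^ p ∣ ∑ b, P b * ∏ l, (X - C (α l)) ^ (M * (b l : ℕ))) : P = 0 := by
  have hp1 : 1 < p := (Fact.out : p.Prime).one_lt
  have hD0 : NeZero D := ⟨by rintro rfl; omega⟩
  set c : ι → ZMod p := fun l => β - α l with hc
  have hc0 : ∀ l, c l ≠ 0 := fun l => sub_ne_zero.2 (hβ l)
  set W := mulMatrix α c P with hW
  have hdetdeg : W.det.natDegree < p := by
    refine (natDegree_det_le W (d := A + Fintype.card ι) fun i j => ?_).trans_lt ?_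
    · refine natDegree_mul_le.trans ?_
      have := natDegree_carryPoly_le α c (i - j) j
      have := hP (i - j)
      omega
    · simpa using hA
  have hfrob : ∀ a : ZMod p, (X - C a) ^ p = (X ^ p - C a : (ZMod p)[X]) := fun a => by
    rw [sub_pow_char, ← C_pow, ZMod.pow_card]
  -- modulo `(X - β) ^ p`
  have hdet : W.det = 0 := by
    set φ := Ideal.Quotient.mk (Ideal.span {((X : (ZMod p)[X]) - C β) ^ p}) with hφ
    have hy : ∀ l, φ (X - C (α l)) * (φ ((X - C (α l)) ^ M)) ^ D = φ (C (c l)) := by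
      intro l
      rw [← map_pow, ← map_mul, ← pow_mul, hD, ← pow_succ', Nat.sub_add_cancel hp1.le]
      refine Ideal.Quotient.eq.2 (Ideal.mem_span_singleton.2 ?_)
      rw [hfrob, hfrob, hc, C_sub]
      exact ⟨1, by ring⟩
    have hz : ∑ b, φ (P b) * ∏ l, φ ((X - C (α l)) ^ M) ^ (b l : ℕ) = 0 := by
      have : φ (∑ b, P b * ∏ l, (X - C (α l)) ^ (M * (b l : ℕ))) = 0 :=
        Ideal.Quotient.eq_zero_iff_mem.2 (Ideal.mem_span_singleton.2 h)
      rw [← this, map_sum]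
      refine Finset.sum_congr rfl fun b _ => ?_
      rw [map_mul, map_prod]
      congr 1
      refine Finset.prod_congr rfl fun l _ => ?_
      simp only [pow_mul, map_pow]
    set v : (ι → Fin D) → _ := fun e => ∏ l, φ ((X - C (α l)) ^ M) ^ (e l : ℕ) with hv
    have hvW : Matrix.vecMul v (W.map φ) = 0 := by
      funext b'
      have := sum_map_mulMatrix α c φ _ hy P b'
      rw [hz, mul_zero, zero_mul] at this
      exact this
    have h0 : (W.map φ).det • v = 0 := by
      have := congrArg (fun u => Matrix.vecMul u (W.map φ).adjugate) hvW
      simp only [Matrix.vecMul_vecMul, Matrix.mul_adjugate, Matrix.zero_vecMul] at this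
      rw [← this]
      simp [Matrix.vecMul_smul]
    have h1 := congrFun h0 0
    simp only [Pi.smul_apply, Pi.zero_apply, hv, Fin.val_zero, pow_zero, Finset.prod_const_one,
      smul_eq_mul, mul_one] at h1
    have h2 : φ W.det = 0 := by rw [← h1, RingHom.map_det]; rfl
    have h3 := Ideal.mem_span_singleton.1 (Ideal.Quotient.eq_zero_iff_mem.1 h2)
    refine eq_zero_of_dvd_of_natDegree_lt h3 ?_
    rwa [natDegree_pow, natDegree_X_sub_C, mul_one]
  obtain ⟨U, hU0, hU⟩ := Matrix.exists_mulVec_eq_zero_iff.2 hdet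
  set L := SeparableClosure (RatFunc (ZMod p))
  set φ := polyToExt (ZMod p) L with hφ
  have hinj : Function.Injective φ := polyToExt_injective _ _
  have hX : ∀ l, φ (X - C (α l)) ≠ 0 := fun l => by
    rw [Ne, map_eq_zero_iff _ hinj]; exact X_sub_C_ne_zero _
  have hDL : NeZero (D : L) := ⟨by
    have hDp : (D : ZMod p) ≠ 0 := by
      rw [Ne, ZMod.natCast_eq_zero_iff]
      intro hd
      have h1 := Nat.le_of_dvd (Nat.pos_of_ne_zero hD0.1) hd
      have h2 : D ≤ p - 1 := Nat.le_of_dvd (by omega) ⟨M, by rw [← hD, mul_comm]⟩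
      omega
    rw [← map_natCast (φ.comp C) D]
    exact (_root_.map_ne_zero _).2 hDp⟩
  have hex : ∀ l, ∃ y : L, φ (X - C (α l)) * y ^ D = φ (C (c l)) := fun l => by
    obtain ⟨y, hy⟩ := IsSepClosed.exists_pow_nat_eq (φ (C (c l)) / φ (X - C (α l))) D
    exact ⟨y, by rw [hy, mul_div_cancel₀ _ (hX l)]⟩
  choose y hy using hex
  have hDd : D ∣ p - 1 := ⟨M, by rw [← hD, mul_comm]⟩
  by_contra hP0
  have h1 : ∑ b', (∑ e, (∏ l, y l ^ (e l : ℕ)) * φ (W e b')) * φ (U b') = 0 := by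
    simp_rw [Finset.sum_mul]
    rw [Finset.sum_comm]
    refine Finset.sum_eq_zero fun e _ => ?_
    have := congrArg φ (congrFun hU e)
    simp only [Matrix.mulVec, dotProduct, map_sum, map_mul, Pi.zero_apply, map_zero] at this
    simp_rw [mul_assoc]
    rw [← Finset.mul_sum, this, mul_zero]
  simp_rw [hW, sum_map_mulMatrix α c φ y hy P, mul_assoc] at h1
  rw [← Finset.mul_sum, ← Finset.mul_sum] at h1
  rcases mul_eq_zero.1 h1 with h1 | h1
  · rw [map_eq_zero_iff _ hinj, Finset.prod_eq_zero_iff] at h1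
    obtain ⟨l, -, hl⟩ := h1
    exact X_sub_C_ne_zero _ hl
  rcases mul_eq_zero.1 h1 with h1 | h1
  · exact hP0 (eq_zero_of_sum_root_monomials hDd hα hc0 y hy P h1)
  · refine hU0 (eq_zero_of_sum_root_monomials hDd hα hc0 y hy U ?_)
    rw [← h1]
    exact Finset.sum_congr rfl fun b _ => mul_comm _ _

theorem X_sub_C_pow_dvd_of_iterate {p : ℕ} [Fact p.Prime] (Q : (ZMod p)[X]) (z : ZMod p)
    (hQ : Q.eval z ≠ 0) (m : ℕ) (hm : m ≤ p) (h : (ZMod p)[X])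
    (hs : ∀ s < m, (((fun f : (ZMod p)[X] => Q * derivative f)^[s]) h).eval z = 0) :
    (X - C z) ^ m ∣ h := by
  induction m generalizing h with
  | zero => simp
  | succ m ih =>
    have hd : (X - C z) ^ m ∣ Q * derivative h := ih (by omega) _ fun s hsm => by
      have := hs (s + 1) (by omega)
      rwa [Function.iterate_succ_apply] at this
    obtain ⟨u, hu⟩ := ih (by omega) h fun s hsm => hs s (by omega)
    rcases Nat.eq_zero_or_pos m with rfl | hm0
    · have h0 := hs 0 (by omega)
      simp only [Function.iterate_zero, id] at h0
      simpa using dvd_iff_isRoot.2 h0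
    have hXp : Prime (X - C z) := prime_X_sub_C z
    have hcop : ¬ (X - C z) ∣ Q := fun hd => hQ (dvd_iff_isRoot.1 hd)
    have hd2 : (X - C z) ^ m ∣ derivative h := hXp.pow_dvd_of_dvd_mul_left m hcop hd
    rw [hu, derivative_mul, derivative_X_sub_C_pow] at hd2
    have hd3 := (dvd_add_left (Dvd.intro _ rfl)).1 hd2
    obtain ⟨k, rfl⟩ : ∃ k, m = k + 1 := ⟨m - 1, by omega⟩
    rw [Nat.add_sub_cancel, pow_succ, mul_comm (C _), mul_assoc] at hd3
    have hd4 := (mul_dvd_mul_iff_left (pow_ne_zero k (X_sub_C_ne_zero z))).1 hd3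
    have hne : ¬ (X - C z) ∣ C ((k + 1 : ℕ) : ZMod p) := by
      rw [dvd_iff_isRoot, IsRoot, eval_C, ZMod.natCast_eq_zero_iff]
      intro hdv
      have := Nat.le_of_dvd (by omega) hdv
      omega
    obtain ⟨w, rfl⟩ := (hXp.dvd_or_dvd hd4).resolve_left hne
    exact ⟨w, by rw [hu]; ring⟩

theorem card_mul_le_natDegree {F : Type*} [Field F] (Z : Finset F) (m : ℕ) (h : F[X])
    (h0 : h ≠ 0) (hZ : ∀ z ∈ Z, (X - C z) ^ m ∣ h) : Z.card * m ≤ h.natDegree := by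
  have hd : ∏ z ∈ Z, (X - C z) ^ m ∣ h := Finset.prod_dvd_of_coprime
    (fun a _ b _ hab => (pairwise_coprime_X_sub_C Function.injective_id hab).pow) hZ
  refine le_trans (le_of_eq ?_) (natDegree_le_of_dvd hd h0)
  rw [natDegree_prod _ _ fun z _ => pow_ne_zero _ (X_sub_C_ne_zero z)]
  simp

/-- The coefficient operator of `∏ (X - α) * d/dX` acting on multiples of
`∏ (X - α) ^ (M * b)`. -/
noncomputable def coeffDeriv {F ι : Type*} [Field F] [Fintype ι] [DecidableEq ι] (α : ι → F)
    (M : ℕ) (b : ι → ℕ) : F[X] →ₗ[F] F[X] :=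
  LinearMap.mulLeft F (∏ l, (X - C (α l))) ∘ₗ derivative +
    LinearMap.mulLeft F (∑ l, C ((M * b l : ℕ) : F) * ∏ l' ∈ Finset.univ.erase l, (X - C (α l')))

theorem coeffDeriv_apply {F ι : Type*} [Field F] [Fintype ι] [DecidableEq ι] (α : ι → F)
    (M : ℕ) (b : ι → ℕ) (k : F[X]) :
    coeffDeriv α M b k = (∏ l, (X - C (α l))) * derivative k +
      (∑ l, C ((M * b l : ℕ) : F) * ∏ l' ∈ Finset.univ.erase l, (X - C (α l'))) * k := rfl

theorem prod_mul_derivative {F ι : Type*} [Field F] [Fintype ι] [DecidableEq ι] (α : ι → F)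
    (M : ℕ) (b : ι → ℕ) (k E : F[X]) (hE : derivative E = 0) :
    (∏ l, (X - C (α l))) * derivative (k * E * ∏ l, (X - C (α l)) ^ (M * b l)) =
      coeffDeriv α M b k * E * ∏ l, (X - C (α l)) ^ (M * b l) := by
  have h : (∏ l, (X - C (α l))) * derivative (∏ l, (X - C (α l)) ^ (M * b l)) =
      (∑ l, C ((M * b l : ℕ) : F) * ∏ l' ∈ Finset.univ.erase l, (X - C (α l'))) *
        ∏ l, (X - C (α l)) ^ (M * b l) := by
    rw [derivative_prod_finset, Finset.mul_sum, Finset.sum_mul]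
    refine Finset.sum_congr rfl fun l _ => ?_
    rw [derivative_X_sub_C_pow, ← Finset.mul_prod_erase _ _ (Finset.mem_univ l),
      ← Finset.mul_prod_erase _ (fun l => (X - C (α l)) ^ (M * b l)) (Finset.mem_univ l)]
    rcases Nat.eq_zero_or_pos (M * b l) with h0 | h0
    · simp [h0]
    · obtain ⟨k, hk⟩ : ∃ k, M * b l = k + 1 := ⟨M * b l - 1, by omega⟩
      rw [hk, Nat.add_sub_cancel, pow_succ]
      ring
  rw [derivative_mul, derivative_mul, hE, mul_zero, add_zero, coeffDeriv_apply]
  linear_combination k * E * h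

theorem natDegree_coeffDeriv_le {F ι : Type*} [Field F] [Fintype ι] [DecidableEq ι] (α : ι → F)
    (M : ℕ) (b : ι → ℕ) (k : F[X]) :
    (coeffDeriv α M b k).natDegree ≤ k.natDegree + Fintype.card ι := by
  have hQ : ∀ s : Finset ι, (∏ l ∈ s, (X - C (α l))).natDegree ≤ Fintype.card ι := fun s => by
    rw [natDegree_finsetProd_X_sub_C_eq_card]
    exact Finset.card_le_univ s
  rw [coeffDeriv_apply]
  refine (natDegree_add_le _ _).trans (max_le ?_ ?_)
  · refine natDegree_mul_le.trans ?_
    have := hQ Finset.univ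
    have := natDegree_derivative_le k
    omega
  · refine natDegree_mul_le.trans ?_
    have : (∑ l, C ((M * b l : ℕ) : F) * ∏ l' ∈ Finset.univ.erase l, (X - C (α l'))).natDegree
        ≤ Fintype.card ι := natDegree_sum_le_of_forall_le _ _ fun l _ =>
      (natDegree_C_mul_le _ _).trans (hQ _)
    omega

theorem natDegree_iterate_coeffDeriv_le {F ι : Type*} [Field F] [Fintype ι] [DecidableEq ι]
    (α : ι → F) (M : ℕ) (b : ι → ℕ) (k : F[X]) (s : ℕ) :
    ((coeffDeriv α M b ^ s) k).natDegree ≤ k.natDegree + s * Fintype.card ι := by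
  induction s with
  | zero => simp
  | succ s ih =>
    rw [pow_succ', Module.End.mul_apply]
    have := natDegree_coeffDeriv_le α M b ((coeffDeriv α M b ^ s) k)
    rw [add_mul]
    omega

theorem iterate_prod_mul_derivative {F ι κ : Type*} [Field F] [Fintype ι] [DecidableEq ι]
    [Fintype κ] (α : ι → F) (M : ℕ) (b : κ → ι → ℕ) (k E : κ → F[X])
    (hE : ∀ i, derivative (E i) = 0) (s : ℕ) :
    ((fun f : F[X] => (∏ l, (X - C (α l))) * derivative f)^[s])
        (∑ i, k i * E i * ∏ l, (X - C (α l)) ^ (M * b i l)) =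
      ∑ i, (coeffDeriv α M (b i) ^ s) (k i) * E i * ∏ l, (X - C (α l)) ^ (M * b i l) := by
  induction s with
  | zero => simp
  | succ s ih =>
    rw [Function.iterate_succ_apply', ih, derivative_sum, Finset.mul_sum]
    refine Finset.sum_congr rfl fun i _ => ?_
    rw [prod_mul_derivative _ _ _ _ _ (hE i), pow_succ', Module.End.mul_apply]

theorem eq_zero_of_sum_pow_mul_eq_zero {R : Type*} [CommRing R] [IsDomain R] {E : R} (hE : E ≠ 0)
    {J : ℕ} (H : Fin J → R) (hdvd : ∀ j, E ∣ H j → H j = 0) (h : ∑ j : Fin J, E ^ (j : ℕ) * H j = 0)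
    (j : Fin J) : H j = 0 := by
  obtain ⟨j, hj⟩ := j
  induction j using Nat.strong_induction_on with
  | _ j ih =>
    apply hdvd
    rw [← Finset.add_sum_erase _ _ (Finset.mem_univ ⟨j, hj⟩)] at h
    have h2 : E ^ (j + 1) ∣ ∑ i ∈ Finset.univ.erase (⟨j, hj⟩ : Fin J), E ^ (i : ℕ) * H i := by
      refine Finset.dvd_sum fun i hi => ?_
      rcases lt_trichotomy (i : ℕ) j with hij | hij | hij
      · rw [ih i hij i.2, mul_zero]; exact dvd_zero _
      · exact absurd (Fin.ext hij) (Finset.ne_of_mem_erase hi)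
      · exact (pow_dvd_pow E hij).mul_right _
    have h3 : E ^ (j + 1) ∣ E ^ j * H ⟨j, hj⟩ := by
      rw [eq_neg_of_add_eq_zero_left h]
      exact h2.neg_right
    rw [pow_succ] at h3
    exact (mul_dvd_mul_iff_left (pow_ne_zero j hE)).1 h3

/-- Stepanov's method for simultaneous conditions on `D`-th power residue classes. -/
theorem stepanov_bound {p D M : ℕ} [Fact p.Prime] (hD : M * D = p - 1)
    {ι : Type*} [Fintype ι] [DecidableEq ι] {α : ι → ZMod p} (hα : Function.Injective α)
    {A J m : ℕ} (hA : D ^ Fintype.card ι * (A + Fintype.card ι) < p) (hm : m ≤ p)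
    (hcount : m * (A + J + m * Fintype.card ι) < D ^ Fintype.card ι * J * A)
    (ζ : ι → ZMod p) (hζ : ∀ l, ζ l ≠ 0) (Z : Finset (ZMod p))
    (hZ : ∀ z ∈ Z, ∀ l, (z - α l) ^ M = ζ l) :
    Z.card * m ≤ A + p * (J + Fintype.card ι) := by
  have hp1 : 1 < p := (Fact.out : p.Prime).one_lt
  have hM0 : M ≠ 0 := by rintro rfl; omega
  have hD0 : D ≠ 0 := by rintro rfl; omega
  obtain ⟨β, hβ⟩ : ∃ β, ∀ l, β ≠ α l := by
    by_contra! hcon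
    have hle : p ≤ Fintype.card ι := by
      rw [← ZMod.card p]
      exact Fintype.card_le_of_surjective α fun β => by
        obtain ⟨l, hl⟩ := hcon β
        exact ⟨l, hl.symm⟩
    have : 1 ≤ D ^ Fintype.card ι := Nat.one_le_pow _ _ (Nat.pos_of_ne_zero hD0)
    nlinarith
  set κ := (ι → Fin D) × Fin J
  set r := Fintype.card ι with hr
  set N := A + J + m * r with hN
  let b : κ → ι → ℕ := fun i l => i.1 l
  let Φ : (κ → degreeLT (ZMod p) A) →ₗ[ZMod p] (Fin m → Fin N → ZMod p) :=
    LinearMap.pi fun s => LinearMap.pi fun t => ∑ i : κ,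
      lcoeff (ZMod p) t ∘ₗ LinearMap.mulLeft (ZMod p)
          (C (∏ l, ζ l ^ b i l) * (X - C β) ^ (i.2 : ℕ)) ∘ₗ
        (coeffDeriv α M (b i) ^ (s : ℕ)) ∘ₗ (degreeLT (ZMod p) A).subtype ∘ₗ LinearMap.proj i
  have hfin : Module.finrank (ZMod p) (degreeLT (ZMod p) A) = A := by
    rw [(degreeLTEquiv (ZMod p) A).finrank_eq, Module.finrank_fin_fun]
  have : Module.Finite (ZMod p) (degreeLT (ZMod p) A) :=
    Module.Finite.equiv (degreeLTEquiv (ZMod p) A).symm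
  have hker : LinearMap.ker Φ ≠ ⊥ := by
    refine LinearMap.ker_ne_bot_of_finrank_lt ?_
    have e1 : Module.finrank (ZMod p) (κ → degreeLT (ZMod p) A) = D ^ r * J * A := by
      rw [Module.finrank_pi_fintype]
      simp [hfin, κ, r]
    have e2 : Module.finrank (ZMod p) (Fin m → Fin N → ZMod p) = m * N := by
      rw [Module.finrank_pi_fintype]
      simp
    rwa [e1, e2]
  obtain ⟨k, hk, hk0⟩ := (Submodule.ne_bot_iff _).1 hker
  have hA0 : 0 < A := by
    rcases Nat.eq_zero_or_pos A with rfl | h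
    · simp at hcount
    · exact h
  have hkdeg : ∀ i, (k i : (ZMod p)[X]).natDegree ≤ A - 1 := fun i => by
    have h1 := mem_degreeLT.1 (k i).2
    by_cases h0 : (k i : (ZMod p)[X]) = 0
    · simp [h0]
    · have := (natDegree_lt_iff_degree_lt h0).2 h1
      omega
  have hR : ∀ s < m, ∑ i : κ, C (∏ l, ζ l ^ b i l) * (X - C β) ^ (i.2 : ℕ) *
      (coeffDeriv α M (b i) ^ s) (k i) = 0 := by
    intro s hs
    have hdeg : (∑ i : κ, C (∏ l, ζ l ^ b i l) * (X - C β) ^ (i.2 : ℕ) *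
        (coeffDeriv α M (b i) ^ s) (k i)).natDegree ≤ (J - 1) + (A - 1 + s * r) := by
      refine natDegree_sum_le_of_forall_le _ _ fun i _ => natDegree_mul_le.trans ?_
      refine add_le_add ((natDegree_C_mul_le _ _).trans ?_) ?_
      · rw [natDegree_pow, natDegree_X_sub_C]
        have := i.2.2
        omega
      · refine (natDegree_iterate_coeffDeriv_le _ _ _ _ _).trans ?_
        exact add_le_add (hkdeg i) le_rfl
    ext t
    rw [coeff_zero]
    by_cases ht : t < N
    · have := congrFun (congrFun (LinearMap.mem_ker.1 hk) ⟨s, hs⟩) ⟨t, ht⟩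
      simpa [Φ, finsetSum_coeff, mul_assoc] using this
    · refine coeff_eq_zero_of_natDegree_lt (hdeg.trans_lt ?_)
      have : s * r ≤ m * r := Nat.mul_le_mul_right _ hs.le
      omega
  set E : (ZMod p)[X] := (X - C β) ^ p with hE
  have hE0 : derivative E = 0 := by simp [hE, derivative_X_sub_C_pow]
  set h : (ZMod p)[X] := ∑ i : κ, (k i : (ZMod p)[X]) * E ^ (i.2 : ℕ) *
    ∏ l, (X - C (α l)) ^ (M * b i l) with hh
  have hne : h ≠ 0 := by
    intro h0
    apply hk0
    set H : Fin J → (ZMod p)[X] := fun j => ∑ c : ι → Fin D, (k (c, j) : (ZMod p)[X]) *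
      ∏ l, (X - C (α l)) ^ (M * (c l : ℕ)) with hH
    have hsum : ∑ j : Fin J, E ^ (j : ℕ) * H j = 0 := by
      rw [← h0, hh, Fintype.sum_prod_type_right]
      refine Finset.sum_congr rfl fun j _ => ?_
      rw [hH, Finset.mul_sum]
      refine Finset.sum_congr rfl fun c _ => ?_
      simp only [b]
      ring
    have hz : ∀ j, E ∣ H j → ∀ c, (k (c, j) : (ZMod p)[X]) = 0 := fun j hd c =>
      congrFun (eq_zero_of_X_sub_C_pow_dvd hD hα hβ hA (fun c => (k (c, j) : (ZMod p)[X]))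
        (fun c => (hkdeg _).trans (Nat.sub_le _ _)) hd) c
    have hHz := eq_zero_of_sum_pow_mul_eq_zero (pow_ne_zero _ (X_sub_C_ne_zero β)) H
      (fun j hd => by
        simp only [hH]
        exact Finset.sum_eq_zero fun c _ => by rw [hz j hd c, zero_mul]) hsum
    funext i
    exact Subtype.ext (hz i.2 (by rw [hHz]; exact dvd_zero _) i.1)
  have hdvd : ∀ z ∈ Z, (X - C z) ^ m ∣ h := by
    intro z hz
    refine X_sub_C_pow_dvd_of_iterate (∏ l, (X - C (α l))) z ?_ m hm h fun s hs => ?_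
    · rw [eval_prod, Finset.prod_ne_zero_iff]
      intro l _ h0
      rw [eval_sub, eval_X, eval_C] at h0
      have := hZ z hz l
      rw [h0, zero_pow hM0] at this
      exact hζ l this.symm
    · rw [hh, iterate_prod_mul_derivative α M b (fun i => (k i : (ZMod p)[X])) _ (fun i => by
        rw [derivative_pow, hE0, mul_zero]), ← eval_zero (x := z), ← hR s hs, eval_finsetSum,
        eval_finsetSum]
      refine Finset.sum_congr rfl fun i _ => ?_
      simp only [eval_mul, eval_pow, eval_sub, eval_X, eval_C, eval_prod, hE, ZMod.pow_card]
      simp_rw [pow_mul, hZ z hz]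
      ring
  refine (card_mul_le_natDegree Z m h hne hdvd).trans ?_
  refine natDegree_sum_le_of_forall_le _ _ fun i _ => natDegree_mul_le.trans ?_
  have h1 : (∏ l, (X - C (α l)) ^ (M * b i l)).natDegree ≤ r * p := by
    refine (natDegree_prod_le _ _).trans
      ((Finset.sum_le_card_nsmul _ _ p fun l _ => ?_).trans (by simp [hr]))
    rw [natDegree_pow, natDegree_X_sub_C, mul_one]
    have h2 : b i l ≤ D := (i.1 l).2.le
    calc M * b i l ≤ M * D := Nat.mul_le_mul_left _ h2
      _ ≤ p := by omega
  have h2 : ((k i : (ZMod p)[X]) * E ^ (i.2 : ℕ)).natDegree ≤ (A - 1) + p * J := by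
    refine natDegree_mul_le.trans (add_le_add (hkdeg i) ?_)
    rw [hE, natDegree_pow, natDegree_pow, natDegree_X_sub_C, mul_one, mul_comm]
    exact Nat.mul_le_mul_left _ i.2.2.le
  rw [mul_add, mul_comm p r]
  omega

theorem card_mul_le_of_pow_eq {p D M : ℕ} [Fact p.Prime] (hD : M * D = p - 1)
    (S : Finset (ZMod p)) {J : ℕ} (hJ : 2 ≤ J)
    (hsmall : D ^ S.card * (J ^ 2 * (1 + D ^ S.card * S.card) + S.card) < p)
    (ζ : S → ZMod p) (hζ : ∀ s, ζ s ≠ 0) (Z : Finset (ZMod p))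
    (hZ : ∀ z ∈ Z, ∀ s : S, (z + s) ^ M = ζ s) :
    Z.card * (D ^ S.card * (J - 1)) ≤ p * (J + S.card + 1) := by
  have hp1 : 1 < p := (Fact.out : p.Prime).one_lt
  have hD0 : 0 < D := Nat.pos_of_ne_zero (by rintro rfl; omega)
  have hc : Fintype.card S = S.card := Fintype.card_coe S
  have hn : 1 ≤ D ^ S.card := Nat.one_le_pow _ _ hD0
  have hα : Function.Injective fun s : S => -(s : ZMod p) := fun a b h => Subtype.ext (neg_injective h)
  generalize hrd : S.card = r at *
  generalize hnd : D ^ r = n at *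
  obtain ⟨j, rfl⟩ : ∃ j, J = j + 2 := ⟨J - 2, by omega⟩
  have hA : (j + 2) ^ 2 * (1 + n * r) ≤ p := by nlinarith
  have key := stepanov_bound (A := (j + 2) ^ 2 * (1 + n * r)) (J := j + 2) (m := n * (j + 1)) hD hα
    (by rw [hc, hnd]; exact hsmall) (by
      have h1 : j + 1 ≤ (j + 2) ^ 2 * (1 + n * r) + r := by nlinarith [Nat.zero_le (n * r)]
      exact (Nat.mul_le_mul_left n h1).trans hsmall.le)
    (by
      rw [hc, hnd, mul_assoc n, mul_assoc n, mul_assoc n]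
      refine Nat.mul_lt_mul_of_pos_left ?_ hn
      nlinarith [Nat.zero_le (n * r), Nat.zero_le (n * r * j)]) ζ hζ Z (fun z hz s => by
        rw [sub_neg_eq_add]; exact hZ z hz s)
  rw [hc] at key
  rw [show j + 2 - 1 = j + 1 by omega]
  refine key.trans ?_
  linarith

theorem ZMod.exists_isPrimitiveRoot {p D M : ℕ} [Fact p.Prime] (hD : M * D = p - 1) :
    ∃ g : ZMod p, IsPrimitiveRoot g D := by
  obtain ⟨g, hg⟩ := IsCyclic.exists_generator (α := (ZMod p)ˣ)
  have h1 : orderOf g = p - 1 := by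
    rw [orderOf_eq_card_of_forall_mem_zpowers hg, Nat.card_eq_fintype_card, ZMod.card_units]
  have hp1 : 1 < p := (Fact.out : p.Prime).one_lt
  have h2 : IsPrimitiveRoot (g : ZMod p) (p - 1) := by
    rw [IsPrimitiveRoot.iff_orderOf, orderOf_units, h1]
  exact ⟨_, h2.pow (by omega) hD.symm⟩

theorem abs_card_filter_shifts_sub_le {p D M : ℕ} [Fact p.Prime] (hD : M * D = p - 1)
    (S : Finset (ZMod p)) {J : ℕ} (hJ : 2 ≤ J)
    (hsmall : D ^ S.card * (J ^ 2 * (1 + D ^ S.card * S.card) + S.card) < p) :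
    |((Finset.univ.filter fun x : ZMod p => ∀ s ∈ S, (x + s) ^ M ∈ primitiveRoots D (ZMod p)).card : ℝ)
      - p * ((D.totient : ℝ) / D) ^ S.card| ≤ p * ((S.card + 2 : ℝ) / (J - 1)) + S.card := by
  classical
  have hp1 : 1 < p := (Fact.out : p.Prime).one_lt
  have hD0 : 0 < D := Nat.pos_of_ne_zero (by rintro rfl; omega)
  have hM0 : M ≠ 0 := by rintro rfl; omega
  obtain ⟨g, hg⟩ := ZMod.exists_isPrimitiveRoot hD
  set X := Finset.univ.filter fun x : ZMod p => ∀ s ∈ S, (x + s) ^ M ∈ primitiveRoots D (ZMod p) with hX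
  set V := Finset.univ.filter fun x : ZMod p => (∀ s ∈ S, x + s ≠ 0) ∧ x ∉ X with hV
  let cls : ZMod p → S → ZMod p := fun x s => (x + s) ^ M
  set G : Finset (S → ZMod p) := Fintype.piFinset fun _ => primitiveRoots D (ZMod p) with hG
  set U : Finset (S → ZMod p) := Fintype.piFinset fun _ => nthRootsFinset D (1 : ZMod p) with hU
  have hGc : G.card = D.totient ^ S.card := by
    rw [hG, Fintype.card_piFinset]; simp [hg.card_primitiveRoots]
  have hUc : U.card = D ^ S.card := by
    rw [hU, Fintype.card_piFinset]; simp [hg.card_nthRootsFinset]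
  have hGU : G ⊆ U := Fintype.piFinset_subset _ _ fun _ ζ hζ => by
    rw [mem_nthRootsFinset hD0]
    exact ((mem_primitiveRoots hD0).1 hζ).pow_eq_one
  have hJ' : (0 : ℝ) < J - 1 := by
    have : (2 : ℝ) ≤ J := by exact_mod_cast hJ
    linarith
  have hD' : (0 : ℝ) < D := by exact_mod_cast hD0
  set δ : ℝ := (S.card + 2 : ℝ) / (J - 1) with hδ
  have hfib : ∀ ζ ∈ U, ∀ W : Finset (ZMod p),
      ((W.filter fun x => cls x = ζ).card : ℝ) ≤ p / D ^ S.card * (1 + δ) := by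
    intro ζ hζ W
    have h1 := card_mul_le_of_pow_eq hD S hJ hsmall ζ (fun s h0 => by
      have := (mem_nthRootsFinset hD0 1).1 (Fintype.mem_piFinset.1 hζ s)
      rw [h0, zero_pow hD0.ne'] at this
      exact zero_ne_one this) (W.filter fun x => cls x = ζ) (fun z hz s =>
        congrFun (Finset.mem_filter.1 hz).2 s)
    have h2 : ((W.filter fun x => cls x = ζ).card : ℝ) * (D ^ S.card * (J - 1)) ≤
        p * (J + S.card + 1) := by
      have : ((J - 1 : ℕ) : ℝ) = J - 1 := by rw [Nat.cast_sub (by omega)]; simp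
      rw [← this]
      exact_mod_cast h1
    rw [← le_div_iff₀ (by positivity)] at h2
    refine h2.trans (le_of_eq ?_)
    rw [hδ]
    field_simp
    ring
  have hcount : ∀ (W : Finset (ZMod p)) (T : Finset (S → ZMod p)), T ⊆ U → (∀ x ∈ W, cls x ∈ T) →
      (W.card : ℝ) ≤ T.card * (p / D ^ S.card * (1 + δ)) := by
    intro W T hT hW
    rw [Finset.card_eq_sum_card_fiberwise hW]
    push_cast
    rw [← nsmul_eq_mul]
    exact Finset.sum_le_card_nsmul _ _ _ fun ζ hζ => hfib ζ (hT hζ) W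
  have hXle := hcount X G hGU fun x hx => by
    rw [hG, Fintype.mem_piFinset]
    exact fun s => (Finset.mem_filter.1 hx).2 s s.2
  have hVle := hcount V (U \ G) Finset.sdiff_subset fun x hx => by
    obtain ⟨hx1, hx2⟩ := (Finset.mem_filter.1 hx).2
    rw [Finset.mem_sdiff, hU, hG, Fintype.mem_piFinset, Fintype.mem_piFinset]
    refine ⟨fun s => ?_, fun hc => hx2 ?_⟩
    · rw [mem_nthRootsFinset hD0]
      change ((x + s) ^ M) ^ D = 1
      rw [← pow_mul, hD]
      exact ZMod.pow_card_sub_one_eq_one (hx1 s s.2)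
    · rw [hX, Finset.mem_filter]
      exact ⟨Finset.mem_univ _, fun s hs => hc ⟨s, hs⟩⟩
  have htot : p ≤ X.card + V.card + S.card := by
    have : (Finset.univ : Finset (ZMod p)) ⊆ X ∪ V ∪ S.image fun s => -s := by
      intro x _
      by_cases h1 : x ∈ X
      · simp [h1]
      by_cases h2 : ∀ s ∈ S, x + s ≠ 0
      · exact Finset.mem_union_left _ (Finset.mem_union_right _ (by simpa [hV, h1] using h2))
      · push Not at h2
        obtain ⟨s, hs, h0⟩ := h2
        refine Finset.mem_union_right _ (Finset.mem_image.2 ⟨s, hs, ?_⟩)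
        linear_combination -h0
    calc p = (Finset.univ : Finset (ZMod p)).card := by rw [Finset.card_univ, ZMod.card]
      _ ≤ _ := Finset.card_le_card this
      _ ≤ _ := (Finset.card_union_le _ _).trans
        (add_le_add (Finset.card_union_le _ _) Finset.card_image_le)
  have htot' : (p : ℝ) ≤ X.card + V.card + S.card := by exact_mod_cast htot
  have hUG : ((U \ G).card : ℝ) = D ^ S.card - D.totient ^ S.card := by
    rw [Finset.cast_card_sdiff hGU, hUc, hGc]; push_cast; ring
  rw [hUG] at hVle
  rw [hGc] at hXle
  have hδ0 : 0 ≤ δ := by positivity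
  have hp0 : (0 : ℝ) ≤ p := Nat.cast_nonneg _
  set u : ℝ := ((D.totient : ℝ) / D) ^ S.card with hu
  have hu0 : 0 ≤ u := by positivity
  have hu1 : u ≤ 1 := pow_le_one₀ (by positivity) (div_le_one_of_le₀ (by
    exact_mod_cast Nat.totient_le D) hD'.le)
  have e1 : ((D.totient ^ S.card : ℕ) : ℝ) * (p / D ^ S.card * (1 + δ)) = p * u * (1 + δ) := by
    rw [hu, div_pow]; push_cast; ring
  have e2 : ((D : ℝ) ^ S.card - D.totient ^ S.card) * (p / D ^ S.card * (1 + δ)) =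
      p * (1 - u) * (1 + δ) := by
    rw [hu, div_pow]; field_simp
  rw [e1] at hXle
  rw [e2] at hVle
  have h3 : 0 ≤ p * δ * (1 - u) := by have := sub_nonneg.2 hu1; positivity
  have h4 : 0 ≤ p * δ * u := by positivity
  have h5 : (0 : ℝ) ≤ S.card := Nat.cast_nonneg _
  rw [abs_le]
  constructor <;> nlinarith

end

theorem abs_one_sub_pow_sub_sum_le {t : ℝ} (h0 : 0 ≤ t) (h1 : t ≤ 1) (N m : ℕ) :
    |(1 - t) ^ N - ∑ i ∈ Finset.range m, (-1) ^ i * (N.choose i : ℝ) * t ^ i| ≤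
      N.choose m * t ^ m := by
  induction N generalizing m with
  | zero =>
    cases m with
    | zero => simp
    | succ m => simp [Finset.sum_range_succ']
  | succ N ih =>
    cases m with
    | zero =>
      simpa [abs_of_nonneg (pow_nonneg (sub_nonneg.2 h1) (N + 1))] using
        pow_le_one₀ (sub_nonneg.2 h1) (by linarith)
    | succ m =>
      have h : ∑ i ∈ Finset.range (m + 1), (-1) ^ i * ((N + 1).choose i : ℝ) * t ^ i =
          (∑ i ∈ Finset.range (m + 1), (-1) ^ i * (N.choose i : ℝ) * t ^ i) -
            t * ∑ i ∈ Finset.range m, (-1) ^ i * (N.choose i : ℝ) * t ^ i := by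
        rw [Finset.sum_range_succ', Finset.sum_range_succ' _ m, Finset.mul_sum,
          add_sub_right_comm, ← Finset.sum_sub_distrib]
        simp only [Nat.choose_zero_right]
        congr 1
        refine Finset.sum_congr rfl fun i _ => ?_
        rw [Nat.choose_succ_succ]
        push_cast
        ring
      have e : (1 - t) ^ (N + 1) -
          ∑ i ∈ Finset.range (m + 1), (-1) ^ i * ((N + 1).choose i : ℝ) * t ^ i =
          ((1 - t) ^ N - ∑ i ∈ Finset.range (m + 1), (-1) ^ i * (N.choose i : ℝ) * t ^ i) -
          t * ((1 - t) ^ N - ∑ i ∈ Finset.range m, (-1) ^ i * (N.choose i : ℝ) * t ^ i) := by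
        rw [h]; ring
      rw [e]
      refine (abs_sub _ _).trans ((add_le_add (ih (m + 1)) (b := _)
        (d := t * (N.choose m * t ^ m)) ?_).trans (le_of_eq ?_))
      · rw [abs_mul, abs_of_nonneg h0]
        exact mul_le_mul_of_nonneg_left (ih m) h0
      · rw [Nat.choose_succ_succ]
        push_cast
        ring

theorem sum_choose_le_pow (N m : ℕ) : ∑ i ∈ Finset.range (m + 1), N.choose i ≤ (N + 1) ^ m := by
  rw [add_pow]
  refine Finset.sum_le_sum fun i hi => ?_
  rw [one_pow, mul_one]
  refine (Nat.choose_le_pow N i).trans (Nat.le_mul_of_pos_right _ (Nat.choose_pos ?_))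
  rw [Finset.mem_range] at hi
  omega

open Classical in
/-- Lower bound for the number of points at which exactly the first and the last of `k + 1`
almost independent events of probability `t` occur. -/
theorem card_gap_ge {X : Type*} [Fintype X] (E : ℕ → X → Prop)
    {P t e : ℝ} (h0 : 0 ≤ t) (h1 : t ≤ 1) (hP : 0 ≤ P) (he : 0 ≤ e) {K m : ℕ}
    (H : ∀ S : Finset ℕ, S ⊆ Finset.range (K + 1) → S.card ≤ m + 2 →
      |((Finset.univ.filter fun x : X => ∀ i ∈ S, E i x).card : ℝ) - P * t ^ S.card| ≤ e)
    {k : ℕ} (hk : 1 ≤ k) (hkK : k ≤ K) :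
    P * t ^ 2 * ((1 - t) ^ (k - 1) - 2 * ((k - 1).choose m * t ^ m)) - e * k ^ m ≤
      (Finset.univ.filter fun x : X => E 0 x ∧ E k x ∧ ∀ i ∈ Finset.Ioo 0 k, ¬ E i x).card := by
  set I := Finset.Ioo 0 k with hI
  have hIc : I.card = k - 1 := by simp [hI]
  set N := k - 1 with hN
  set W := Finset.univ.filter fun x : X => E 0 x ∧ E k x with hW
  let V : X → ℕ := fun x => (I.filter fun i => E i x).card
  have hgap : ((Finset.univ.filter fun x : X => E 0 x ∧ E k x ∧ ∀ i ∈ I, ¬ E i x).card : ℝ) =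
      ∑ x ∈ W, (1 - 1 : ℝ) ^ V x := by
    simp_rw [sub_self, zero_pow_eq]
    rw [Finset.sum_boole, hW, Finset.filter_filter]
    congr 2
    refine Finset.filter_congr fun x _ => ?_
    simp [V, Finset.filter_eq_empty_iff, and_assoc]
  have hch : ∀ i, ∑ x ∈ W, ((V x).choose i : ℝ) = ∑ S ∈ I.powersetCard i,
      ((Finset.univ.filter fun x : X => ∀ j ∈ insert 0 (insert k S), E j x).card : ℝ) := by
    intro i
    have h (x : X) : ((V x).choose i : ℝ) =
        ∑ S ∈ I.powersetCard i, if ∀ j ∈ S, E j x then (1 : ℝ) else 0 := by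
      rw [Finset.sum_boole, ← Finset.card_powersetCard]
      congr 2
      ext S
      simp only [Finset.mem_powersetCard, Finset.mem_filter, Finset.subset_iff]
      grind
    simp_rw [h]
    rw [Finset.sum_comm]
    refine Finset.sum_congr rfl fun S _ => ?_
    rw [Finset.sum_boole, hW, Finset.filter_filter]
    congr 2
    ext x
    simp [and_assoc]
  have hS : ∀ i ≤ m, |∑ x ∈ W, ((V x).choose i : ℝ) - P * t ^ 2 * (N.choose i * t ^ i)| ≤
      e * N.choose i := by
    intro i hi
    have hcard : ∀ S ∈ I.powersetCard i, (insert 0 (insert k S)).card = i + 2 ∧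
        insert 0 (insert k S) ⊆ Finset.range (K + 1) := by
      intro S hS
      obtain ⟨hSI, hSc⟩ := Finset.mem_powersetCard.1 hS
      have hk' : k ∉ S := fun h => by have := hSI h; simp [hI] at this
      have h0' : 0 ∉ insert k S := fun h => by
        rcases Finset.mem_insert.1 h with h | h
        · omega
        · have := hSI h; simp [hI] at this
      refine ⟨by rw [Finset.card_insert_of_notMem h0', Finset.card_insert_of_notMem hk', hSc], ?_⟩
      intro j hj
      rw [Finset.mem_insert, Finset.mem_insert] at hj
      rw [Finset.mem_range]
      rcases hj with rfl | rfl | hj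
      · omega
      · omega
      · have := Finset.mem_Ioo.1 (hSI hj)
        omega
    have e1 : ∑ x ∈ W, ((V x).choose i : ℝ) - P * t ^ 2 * (N.choose i * t ^ i) =
        ∑ S ∈ I.powersetCard i, (((Finset.univ.filter fun x : X =>
          ∀ j ∈ insert 0 (insert k S), E j x).card : ℝ) - P * t ^ (i + 2)) := by
      rw [hch, Finset.sum_sub_distrib, Finset.sum_const, Finset.card_powersetCard, hIc,
        nsmul_eq_mul]
      ring
    rw [e1]
    refine (Finset.abs_sum_le_sum_abs _ _).trans ((Finset.sum_le_card_nsmul _ _ e ?_).trans ?_)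
    · intro S hS
      have := H _ (hcard S hS).2 (by rw [(hcard S hS).1]; omega)
      rw [(hcard S hS).1] at this
      refine le_trans (le_of_eq ?_) this
      congr!
    · rw [Finset.card_powersetCard, hIc, nsmul_eq_mul, mul_comm]
  have hpt : ∀ v : ℕ, ∑ i ∈ Finset.range m, (-1) ^ i * (v.choose i : ℝ) - v.choose m ≤
      (1 - 1 : ℝ) ^ v := fun v => by
    have := (abs_le.1 (abs_one_sub_pow_sub_sum_le zero_le_one le_rfl v m)).1
    simp only [one_pow, mul_one] at this
    linarith
  have hge : ∑ i ∈ Finset.range m, (-1) ^ i * ∑ x ∈ W, ((V x).choose i : ℝ) -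
      ∑ x ∈ W, ((V x).choose m : ℝ) ≤ ∑ x ∈ W, (1 - 1 : ℝ) ^ V x := by
    refine le_trans (le_of_eq ?_) (Finset.sum_le_sum fun x _ => hpt (V x))
    rw [Finset.sum_sub_distrib, Finset.sum_comm]
    simp_rw [Finset.mul_sum]
  have hmain : ∑ i ∈ Finset.range m, (-1) ^ i * (P * t ^ 2 * (N.choose i * t ^ i)) -
      ∑ i ∈ Finset.range m, e * N.choose i ≤
      ∑ i ∈ Finset.range m, (-1) ^ i * ∑ x ∈ W, ((V x).choose i : ℝ) := by
    rw [← Finset.sum_sub_distrib]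
    refine Finset.sum_le_sum fun i hi => ?_
    have h2 := hS i (Finset.mem_range.1 hi).le
    have h3 : |(-1) ^ i * ∑ x ∈ W, ((V x).choose i : ℝ) -
        (-1) ^ i * (P * t ^ 2 * (N.choose i * t ^ i))| ≤ e * N.choose i := by
      rw [← mul_sub, abs_mul, abs_pow, abs_neg, abs_one, one_pow, one_mul]
      exact h2
    linarith [(abs_le.1 h3).1]
  have hlast := (abs_le.1 (hS m le_rfl)).2
  have hbon := (abs_le.1 (abs_one_sub_pow_sub_sum_le h0 h1 N m)).2
  have hsum : ∑ i ∈ Finset.range m, e * (N.choose i : ℝ) + e * N.choose m ≤ e * k ^ m := by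
    rw [← Finset.sum_range_succ, ← Finset.mul_sum]
    refine mul_le_mul_of_nonneg_left ?_ he
    have := sum_choose_le_pow N m
    rw [show N + 1 = k by omega] at this
    exact_mod_cast this
  have hfac : ∑ i ∈ Finset.range m, (-1) ^ i * (P * t ^ 2 * (N.choose i * t ^ i)) =
      P * t ^ 2 * ∑ i ∈ Finset.range m, (-1) ^ i * (N.choose i : ℝ) * t ^ i := by
    rw [Finset.mul_sum]
    exact Finset.sum_congr rfl fun i _ => by ring
  have hbon' := mul_le_mul_of_nonneg_left hbon (by positivity : 0 ≤ P * t ^ 2)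
  calc _ ≤ ∑ x ∈ W, (1 - 1 : ℝ) ^ V x := by linarith
    _ = _ := by
      rw [← hgap]
      congr!

theorem one_sub_pow_le_inv {t : ℝ} (h0 : 0 ≤ t) (h1 : t ≤ 1) (n : ℕ) :
    (1 - t) ^ n ≤ (1 + n * t)⁻¹ := by
  rw [← one_div, le_div_iff₀ (by positivity)]
  calc (1 - t) ^ n * (1 + n * t) ≤ (1 - t) ^ n * (1 + t) ^ n :=
        mul_le_mul_of_nonneg_left (one_add_mul_le_pow (by linarith) n)
          (pow_nonneg (sub_nonneg.2 h1) n)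
    _ = (1 - t ^ 2) ^ n := by rw [← mul_pow]; ring
    _ ≤ 1 := pow_le_one₀ (by nlinarith) (by nlinarith)

theorem mul_sum_one_sub_pow_two_mul {t : ℝ} (h1 : t ≤ 1) (L : ℕ) :
    t * ∑ j ∈ Finset.range L, (1 - t) ^ (2 * j) = (1 - (1 - t) ^ (2 * L)) / (2 - t) := by
  have h := mul_neg_geom_sum ((1 - t) ^ 2) L
  simp_rw [← pow_mul] at h
  rw [eq_div_iff (by linarith), ← h]
  ring

open Classical in
theorem exists_sum_card_gap_ge {η : ℝ} (hη : 0 < η) : ∃ m c : ℕ, ∀ t : ℝ, 0 < t → t ≤ 1 →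
    ∃ L : ℕ, L * t ≤ c ∧ ∀ {X : Type} [Fintype X] (E : ℕ → X → Prop) {P e : ℝ}, 0 ≤ P → 0 ≤ e →
      (∀ S : Finset ℕ, S ⊆ Finset.range (2 * L + 1) → S.card ≤ m + 2 →
        |((Finset.univ.filter fun x : X => ∀ i ∈ S, E i x).card : ℝ) - P * t ^ S.card| ≤ e) →
      ∀ b ≤ 1, P * t * ((1 - t) ^ b / (2 - t)) - η * (P * t) - e * (2 * c / t) ^ (m + 1) ≤
        ∑ j ∈ Finset.range L, ((Finset.univ.filter fun x : X => E 0 x ∧ E (2 * j + 1 + b) x ∧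
          ∀ i ∈ Finset.Ioo 0 (2 * j + 1 + b), ¬ E i x).card : ℝ) := by
  obtain ⟨c₀, hc₀⟩ := exists_nat_gt (1 / η)
  set c := c₀ + 1 with hc
  have hlim := (FloorSemiring.tendsto_pow_div_factorial_atTop (2 * c : ℝ)).const_mul (2 * c : ℝ)
  rw [mul_zero] at hlim
  obtain ⟨m, hm⟩ := (hlim.eventually_lt_const (half_pos hη)).exists
  refine ⟨m, c, fun t h0 h1 => ?_⟩
  set L := ⌈(c₀ : ℝ) / t⌉₊ with hL
  have hLc : L * t ≤ c := by
    have := (Nat.ceil_lt_add_one (by positivity : 0 ≤ (c₀ : ℝ) / t)).le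
    calc (⌈(c₀ : ℝ) / t⌉₊ : ℝ) * t ≤ (c₀ / t + 1) * t := by gcongr
      _ = c₀ + t := by field_simp
      _ ≤ c := by rw [hc]; push_cast; linarith
  refine ⟨L, hLc, ?_⟩
  have hcL : c₀ ≤ L * t := by rw [← div_le_iff₀ h0]; exact Nat.le_ceil _
  intro X _ E P e hP he H b hb
  have hch : ∀ N ≤ 2 * L, (N.choose m : ℝ) * t ^ m ≤ (2 * c) ^ m / m.factorial := fun N hN => by
    have h2 : (N : ℝ) ≤ 2 * L := by exact_mod_cast hN
    calc (N.choose m : ℝ) * t ^ m ≤ N ^ m / m.factorial * t ^ m := by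
          gcongr; exact Nat.choose_le_pow_div m N
      _ = (N * t) ^ m / m.factorial := by rw [mul_pow]; ring
      _ ≤ (2 * c) ^ m / m.factorial := by
          refine div_le_div_of_nonneg_right (pow_le_pow_left₀ (by positivity) ?_ m) (by positivity)
          nlinarith
  have hterm : ∀ j ∈ Finset.range L, P * t ^ 2 * ((1 - t) ^ (2 * j + b) -
      2 * ((2 * c) ^ m / m.factorial)) - e * (2 * L) ^ m ≤
      ((Finset.univ.filter fun x : X => E 0 x ∧ E (2 * j + 1 + b) x ∧
          ∀ i ∈ Finset.Ioo 0 (2 * j + 1 + b), ¬ E i x).card : ℝ) := fun j hj => by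
    have hj' := Finset.mem_range.1 hj
    refine le_trans ?_ (card_gap_ge E h0.le h1 hP he H (k := 2 * j + 1 + b) (by omega) (by omega))
    rw [show 2 * j + 1 + b - 1 = 2 * j + b by omega]
    have h3 : ((2 * j + 1 + b : ℕ) : ℝ) ≤ 2 * L := by
      have : 2 * j + 1 + b ≤ 2 * L := by omega
      exact_mod_cast this
    gcongr
    exact hch _ (by omega)
  refine le_trans ?_ (Finset.sum_le_sum hterm)
  have hinv : (1 - t) ^ (2 * L) ≤ η / 2 := by
    refine (one_sub_pow_le_inv h0.le h1 _).trans ?_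
    have h4 : 1 < c₀ * η := by rwa [div_lt_iff₀ hη] at hc₀
    rw [inv_le_comm₀ (by positivity) (by positivity), inv_div, div_le_iff₀ hη]
    push_cast
    nlinarith
  have hgeo : ∑ j ∈ Finset.range L, P * t ^ 2 * (1 - t) ^ (2 * j + b) =
      P * t * (1 - t) ^ b * ((1 - (1 - t) ^ (2 * L)) / (2 - t)) := by
    rw [← mul_sum_one_sub_pow_two_mul h1, Finset.mul_sum, Finset.mul_sum]
    exact Finset.sum_congr rfl fun j _ => by ring
  have hq : (1 - t) ^ b * ((1 - t) ^ (2 * L) / (2 - t)) ≤ η / 2 := by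
    have h5 : (1 - t) ^ b ≤ 1 := pow_le_one₀ (by linarith) (by linarith)
    have h6 : (1 - t) ^ (2 * L) / (2 - t) ≤ (1 - t) ^ (2 * L) :=
      div_le_self (pow_nonneg (by linarith) _) (by linarith)
    have h7 : 0 ≤ (1 - t) ^ (2 * L) / (2 - t) :=
      div_nonneg (pow_nonneg (by linarith) _) (by linarith)
    exact (mul_le_of_le_one_left h7 h5).trans (h6.trans hinv)
  have hsum : ∑ j ∈ Finset.range L, (P * t ^ 2 * ((1 - t) ^ (2 * j + b) -
      2 * ((2 * c) ^ m / m.factorial)) - e * (2 * L) ^ m) =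
      P * t * ((1 - t) ^ b / (2 - t)) - P * t * ((1 - t) ^ b * ((1 - t) ^ (2 * L) / (2 - t))) -
      P * t * (L * t * 2 * ((2 * c) ^ m / m.factorial)) - e * (L * (2 * L) ^ m) := by
    simp_rw [mul_sub]
    rw [Finset.sum_sub_distrib, Finset.sum_sub_distrib, hgeo, Finset.sum_const, Finset.sum_const,
      Finset.card_range, nsmul_eq_mul, nsmul_eq_mul]
    ring
  rw [hsum]
  have h8 : P * t * ((1 - t) ^ b * ((1 - t) ^ (2 * L) / (2 - t))) ≤ P * t * (η / 2) := by gcongr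
  have h9 : P * t * (L * t * 2 * ((2 * c) ^ m / m.factorial)) ≤ P * t * (η / 2) := by
    gcongr
    refine le_trans (mul_le_mul_of_nonneg_right ?_ (by positivity)) hm.le
    linarith
  have h10 : (L : ℝ) * (2 * L) ^ m ≤ (2 * c / t) ^ (m + 1) := by
    have h11 : 2 * (L : ℝ) ≤ 2 * c / t := by rw [le_div_iff₀ h0]; linarith
    calc (L : ℝ) * (2 * L) ^ m ≤ (2 * L) * (2 * L) ^ m := by
          gcongr
          linarith [(Nat.cast_nonneg L : (0 : ℝ) ≤ L)]
      _ = (2 * L) ^ (m + 1) := by ring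
      _ ≤ _ := by gcongr
  have h12 := mul_le_mul_of_nonneg_left h10 he
  linarith

open Classical in
/-- The elements of `A` (as residues in `[0, p)`) whose successor in `A` is at a distance congruent
to `b` modulo `2`. -/
noncomputable def gapStarts {p : ℕ} (A : Finset (ZMod p)) (b : ℕ) : Finset ℕ :=
  (Finset.range p).filter fun x => (x : ZMod p) ∈ A ∧ ∃ k, k % 2 = b ∧ 0 < k ∧ x + k < p ∧
    ((x + k : ℕ) : ZMod p) ∈ A ∧ ∀ i ∈ Finset.Ioo 0 k, ((x + i : ℕ) : ZMod p) ∉ A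

open Classical in
theorem sum_card_gap_le {p : ℕ} [NeZero p] (A B : Finset (ZMod p)) (L b : ℕ) (hAB : A ⊆ B) :
    ∑ j ∈ Finset.range L, (Finset.univ.filter fun x : ZMod p => x + (0 : ℕ) ∈ B ∧
      x + (2 * j + 1 + b : ℕ) ∈ B ∧ ∀ i ∈ Finset.Ioo 0 (2 * j + 1 + b), ¬ x + (i : ℕ) ∈ B).card ≤
      (gapStarts A ((1 + b) % 2)).card + 2 * (B \ A).card + (2 * L + b) := by
  rw [← Finset.card_sigma]
  set Q := (Finset.range L).sigma fun j => Finset.univ.filter fun x : ZMod p => x + (0 : ℕ) ∈ B ∧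
      x + (2 * j + 1 + b : ℕ) ∈ B ∧ ∀ i ∈ Finset.Ioo 0 (2 * j + 1 + b), ¬ x + (i : ℕ) ∈ B with hQ
  have hmem : ∀ q ∈ Q, q.1 < L ∧ q.2 ∈ B ∧ q.2 + (2 * q.1 + 1 + b : ℕ) ∈ B ∧
      ∀ i ∈ Finset.Ioo 0 (2 * q.1 + 1 + b), q.2 + (i : ℕ) ∉ B := fun q hq => by
    simpa [hQ] using hq
  have hinj1 : ∀ q ∈ Q, ∀ q' ∈ Q, q.2 = q'.2 → q.1 = q'.1 := by
    have aux : ∀ q ∈ Q, ∀ q' ∈ Q, q.2 = q'.2 → ¬ q.1 < q'.1 := fun q hq q' hq' h hlt => by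
      refine (hmem q' hq').2.2.2 (2 * q.1 + 1 + b) (Finset.mem_Ioo.2 ⟨by omega, by omega⟩) ?_
      rw [← h]
      exact (hmem q hq).2.2.1
    exact fun q hq q' hq' h => le_antisymm (not_lt.1 (aux q' hq' q hq h.symm))
      (not_lt.1 (aux q hq q' hq' h))
  have hinj2 : ∀ q ∈ Q, ∀ q' ∈ Q, q.2 + (2 * q.1 + 1 + b : ℕ) = q'.2 + (2 * q'.1 + 1 + b : ℕ) →
      q.1 = q'.1 := by
    have aux : ∀ q ∈ Q, ∀ q' ∈ Q, q.2 + (2 * q.1 + 1 + b : ℕ) = q'.2 + (2 * q'.1 + 1 + b : ℕ) →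
        ¬ q.1 < q'.1 := fun q hq q' hq' h hlt => by
      refine (hmem q' hq').2.2.2 (2 * (q'.1 - q.1)) (Finset.mem_Ioo.2 ⟨by omega, by omega⟩) ?_
      convert (hmem q hq).2.1 using 1
      rw [show 2 * q'.1 + 1 + b = 2 * (q'.1 - q.1) + (2 * q.1 + 1 + b) by omega,
        Nat.cast_add (2 * (q'.1 - q.1)), ← add_assoc] at h
      exact (add_right_cancel h).symm
    exact fun q hq q' hq' h => le_antisymm (not_lt.1 (aux q' hq' q hq h.symm))
      (not_lt.1 (aux q hq q' hq' h))
  have hsub : Q ⊆ (Q.filter fun q => q.2.val ∈ gapStarts A ((1 + b) % 2)) ∪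
      (Q.filter fun q => q.2 ∈ B \ A) ∪
      (Q.filter fun q => q.2 + (2 * q.1 + 1 + b : ℕ) ∈ B \ A) ∪
      (Q.filter fun q => q.2.val ∈ Finset.Ico (p - (2 * L + b)) p) := by
    intro q hq
    obtain ⟨hL, h0, h1, h2⟩ := hmem q hq
    have hlt := ZMod.val_lt q.2
    by_cases hA0 : q.2 ∈ A
    swap
    · simp [hq, hA0, h0]
    by_cases hA1 : q.2 + (2 * q.1 + 1 + b : ℕ) ∈ A
    swap
    · refine Finset.mem_union_left _ (Finset.mem_union_right _ (Finset.mem_filter.2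
        ⟨hq, Finset.mem_sdiff.2 ⟨h1, hA1⟩⟩))
    by_cases hw : q.2.val + (2 * q.1 + 1 + b) < p
    swap
    · refine Finset.mem_union_right _ (Finset.mem_filter.2 ⟨hq, Finset.mem_Ico.2 ⟨?_, hlt⟩⟩)
      omega
    refine Finset.mem_union_left _ (Finset.mem_union_left _ (Finset.mem_union_left _
      (Finset.mem_filter.2 ⟨hq, ?_⟩)))
    simp only [gapStarts, Finset.mem_filter, Finset.mem_range, Nat.cast_add q.2.val,
      ZMod.natCast_zmod_val]
    exact ⟨hlt, hA0, 2 * q.1 + 1 + b, by omega, by omega, hw, hA1,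
      fun i hi hiA => h2 i hi (hAB hiA)⟩
  have hfst : ∀ (W : Finset ℕ), (Q.filter fun q => q.2.val ∈ W).card ≤ W.card := fun W =>
    Finset.card_le_card_of_injOn (fun q => q.2.val) (fun q hq => (Finset.mem_filter.1 hq).2)
      fun q hq q' hq' h => by
        have h' := ZMod.val_injective p h
        exact Sigma.ext (hinj1 q (Finset.mem_filter.1 hq).1 q' (Finset.mem_filter.1 hq').1 h')
          (heq_of_eq h')
  have hc1 : (Q.filter fun q => q.2 ∈ B \ A).card ≤ (B \ A).card :=
    Finset.card_le_card_of_injOn (fun q => q.2) (fun _ hq => Finset.mem_coe.2 (Finset.mem_filter.1 hq).2)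
      fun q hq q' hq' h =>
        Sigma.ext (hinj1 q (Finset.mem_filter.1 hq).1 q' (Finset.mem_filter.1 hq').1 h)
          (heq_of_eq h)
  have hc2 : (Q.filter fun q => q.2 + ((2 * q.1 + 1 + b : ℕ) : ZMod p) ∈ B \ A).card ≤ (B \ A).card :=
    Finset.card_le_card_of_injOn (fun q => q.2 + (2 * q.1 + 1 + b : ℕ))
      (fun q hq => (Finset.mem_filter.1 hq).2)
      fun q hq q' hq' h => by
        have h1 := hinj2 q (Finset.mem_filter.1 hq).1 q' (Finset.mem_filter.1 hq').1 h
        refine Sigma.ext h1 (heq_of_eq ?_)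
        simp only [h1] at h
        exact add_right_cancel h
  have h3 := (Finset.card_le_card hsub).trans ((Finset.card_union_le _ _).trans (add_le_add
    ((Finset.card_union_le _ _).trans (add_le_add (Finset.card_union_le _ _) le_rfl)) le_rfl))
  have h4 := hfst (gapStarts A ((1 + b) % 2))
  have h5 := hfst (Finset.Ico (p - (2 * L + b)) p)
  rw [Nat.card_Ico] at h5
  omega

theorem filter_orderOf_eq_image {p : ℕ} [Fact p.Prime] :
    ((Finset.Ico 1 p).filter fun g : ℕ => orderOf (g : ZMod p) = p - 1) =
      (primitiveRoots (p - 1) (ZMod p)).image ZMod.val := by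
  have hp : 1 < p := (Fact.out : p.Prime).one_lt
  ext g
  rw [Finset.mem_filter, Finset.mem_image, Finset.mem_Ico]
  constructor
  · rintro ⟨⟨-, h⟩, ho⟩
    exact ⟨g, (mem_primitiveRoots (by omega)).2 (IsPrimitiveRoot.iff_orderOf.2 ho),
      ZMod.val_cast_of_lt h⟩
  · rintro ⟨x, hx, rfl⟩
    rw [mem_primitiveRoots (by omega)] at hx
    have hx0 : x ≠ 0 := hx.ne_zero (by omega)
    rw [ZMod.natCast_zmod_val]
    exact ⟨⟨Nat.one_le_iff_ne_zero.2 (by simpa using hx0), ZMod.val_lt x⟩, hx.eq_orderOf.symm⟩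

theorem mem_primRootsList {p : ℕ} [Fact p.Prime] {g : ℕ} :
    g ∈ primRootsList p ↔ g < p ∧ (g : ZMod p) ∈ primitiveRoots (p - 1) (ZMod p) := by
  rw [primRootsList, Finset.mem_sort, filter_orderOf_eq_image, Finset.mem_image]
  constructor
  · rintro ⟨x, hx, rfl⟩
    exact ⟨ZMod.val_lt x, by rwa [ZMod.natCast_zmod_val]⟩
  · rintro ⟨h, hg⟩
    exact ⟨g, hg, ZMod.val_cast_of_lt h⟩

theorem card_primitiveRoots_sub_one {p : ℕ} [Fact p.Prime] :
    (primitiveRoots (p - 1) (ZMod p)).card = (p - 1).totient := by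
  obtain ⟨g, hg⟩ := ZMod.exists_isPrimitiveRoot (one_mul (p - 1))
  exact hg.card_primitiveRoots

theorem length_primRootsList {p : ℕ} [Fact p.Prime] :
    (primRootsList p).length = (p - 1).totient := by
  rw [primRootsList, Finset.length_sort, filter_orderOf_eq_image,
    Finset.card_image_of_injective _ (ZMod.val_injective p), card_primitiveRoots_sub_one]

theorem card_gapStarts_le {p : ℕ} [Fact p.Prime] (b : ℕ) :
    (gapStarts (primitiveRoots (p - 1) (ZMod p)) b).card ≤
      ((Finset.range ((p - 1).totient - 1)).filter fun n => seqS p n = b).card := by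
  classical
  refine le_trans (Finset.card_le_card (t := Finset.image (fun n => (primRootsList p).getD n 0)
    ((Finset.range ((p - 1).totient - 1)).filter fun n => seqS p n = b)) ?_) Finset.card_image_le
  intro x hx
  obtain ⟨hxp, hxA, k, hkb, hk0, hkp, hkA, hgap⟩ := by
    simpa only [gapStarts, Finset.mem_filter, Finset.mem_range] using hx
  have hs : (primRootsList p).SortedLT := Finset.sortedLT_sort _
  obtain ⟨i, hi, hix⟩ := List.mem_iff_getElem.1 (mem_primRootsList.2 ⟨hxp, hxA⟩)
  obtain ⟨j, hj, hjx⟩ := List.mem_iff_getElem.1 (mem_primRootsList.2 ⟨hkp, hkA⟩)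
  have hij : i < j := by
    by_contra hcon
    have := hs.strictMono_get.monotone (a := ⟨j, hj⟩) (b := ⟨i, hi⟩) (not_lt.1 hcon)
    simp only [List.get_eq_getElem, hix, hjx] at this
    omega
  have hj1 : j = i + 1 := by
    by_contra hcon
    have hi1 : i + 1 < j := by omega
    have h1 := hs.strictMono_get (a := ⟨i, hi⟩) (b := ⟨i + 1, by omega⟩) (Nat.lt_succ_self i)
    have h2 := hs.strictMono_get (a := ⟨i + 1, by omega⟩) (b := ⟨j, hj⟩) hi1
    simp only [List.get_eq_getElem, hix, hjx] at h1 h2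
    have h3 := (mem_primRootsList.1 (List.getElem_mem (l := primRootsList p) (n := i + 1)
      (by omega))).2
    refine hgap ((primRootsList p)[i + 1] - x) (Finset.mem_Ioo.2 ⟨by omega, by omega⟩) ?_
    rwa [Nat.add_sub_cancel' h1.le]
  subst hj1
  have hlen := length_primRootsList (p := p)
  have hiT : i < (p - 1).totient - 1 := by omega
  refine Finset.mem_image.2 ⟨i, Finset.mem_filter.2 ⟨Finset.mem_range.2 hiT, ?_⟩, ?_⟩
  · rw [seqS, Nat.mod_eq_of_lt hiT, List.getD_eq_getElem _ _ hi, List.getD_eq_getElem _ _ hj, hix,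
      hjx]
    omega
  · rw [List.getD_eq_getElem _ _ hi, hix]

theorem Finset.one_sub_sum_le_prod_one_sub {ι : Type*} (s : Finset ι) (f : ι → ℝ)
    (h0 : ∀ i ∈ s, 0 ≤ f i) (h1 : ∀ i ∈ s, f i ≤ 1) :
    1 - ∑ i ∈ s, f i ≤ ∏ i ∈ s, (1 - f i) := by
  classical
  induction s using Finset.induction_on with
  | empty => simp
  | insert a s ha ih =>
    rw [Finset.sum_insert ha, Finset.prod_insert ha]
    have ih' := ih (fun i hi => h0 i (Finset.mem_insert_of_mem hi))
      fun i hi => h1 i (Finset.mem_insert_of_mem hi)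
    have ha0 := h0 a (Finset.mem_insert_self a s)
    have ha1 := h1 a (Finset.mem_insert_self a s)
    have hs : 0 ≤ ∑ i ∈ s, f i :=
      Finset.sum_nonneg fun i hi => h0 i (Finset.mem_insert_of_mem hi)
    nlinarith [mul_le_mul_of_nonneg_left ih' (sub_nonneg.2 ha1), mul_nonneg ha0 hs]

theorem card_large_primeFactors_mul_le {n N y h : ℕ} (hn : n ≠ 0) (hy : 2 ^ h ≤ y)
    (hny : n < (4 ^ N) ^ (y + 1)) :
    (n.primeFactors.filter fun q => ¬ q ≤ y).card * h ≤ 4 * N * y := by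
  set W := n.primeFactors.filter fun q => ¬ q ≤ y
  have h1 : y ^ W.card ≤ ∏ q ∈ W, q :=
    Finset.pow_card_le_prod _ _ _ fun q hq => (not_le.1 (Finset.mem_filter.1 hq).2).le
  have h2 : ∏ q ∈ W, q ≤ n := Nat.le_of_dvd (Nat.pos_of_ne_zero hn)
    ((Finset.prod_dvd_prod_of_subset _ _ _ (Finset.filter_subset _ _)).trans
      (Nat.prod_primeFactors_dvd n))
  have h3 : 2 ^ (h * W.card) < 2 ^ (2 * N * (y + 1)) := by
    calc 2 ^ (h * W.card) = (2 ^ h) ^ W.card := pow_mul _ _ _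
      _ ≤ y ^ W.card := Nat.pow_le_pow_left hy _
      _ < (4 ^ N) ^ (y + 1) := (h1.trans h2).trans_lt hny
      _ = 2 ^ (2 * N * (y + 1)) := by
        rw [show 4 = 2 ^ 2 from rfl, ← pow_mul, ← pow_mul, mul_assoc]
  have h4 := (Nat.pow_lt_pow_iff_right (by norm_num)).1 h3
  have h5 : 1 ≤ y := Nat.one_le_two_pow.trans hy
  nlinarith [mul_le_mul_of_nonneg_left h5 (Nat.zero_le N)]

theorem totient_eq_mul_prod_real (n : ℕ) :
    (n.totient : ℝ) = n * ∏ q ∈ n.primeFactors, (1 - (q : ℝ)⁻¹) := by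
  have h := congrArg (Rat.cast : ℚ → ℝ) (Nat.totient_eq_mul_prod_factors n)
  push_cast at h
  exact h

/-- Every large `n` has a small divisor `D` with `φ(D) / D` close to `φ(n) / n`. -/
theorem exists_small_divisor_totient {η : ℝ} (hη : 0 < η) {N : ℕ} (hN : 0 < N) (K : ℕ) :
    ∃ P : ℕ, ∀ n : ℕ, P ≤ n → ∃ D Y : ℕ, D ∣ n ∧ 0 < D ∧ D ≤ Y ∧ K ≤ Y ∧ Y ^ N ≤ n ∧
      (1 - η) * (n * ((D.totient : ℝ) / D)) ≤ n.totient ∧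
      (n.totient : ℝ) ≤ n * ((D.totient : ℝ) / D) := by
  obtain ⟨h, hh⟩ := exists_nat_gt (4 * N / η)
  set y₀ := 2 ^ h + K
  refine ⟨(4 ^ N) ^ y₀, fun n hn => ?_⟩
  have hn0 : n ≠ 0 := by
    have : 0 < (4 ^ N) ^ y₀ := by positivity
    omega
  have h4N : 1 < 4 ^ N := Nat.one_lt_pow hN.ne' (by norm_num)
  set y := Nat.log (4 ^ N) n with hy
  have hy0 : y₀ ≤ y := Nat.le_log_of_pow_le h4N hn
  have hylt : n < (4 ^ N) ^ (y + 1) := Nat.lt_pow_succ_log_self h4N n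
  set D := ∏ q ∈ n.primeFactors.filter (fun q => q ≤ y), q with hD
  have hprime : ∀ q ∈ n.primeFactors.filter (fun q => q ≤ y), q.Prime := fun q hq =>
    Nat.prime_of_mem_primeFactors (Finset.mem_filter.1 hq).1
  have hDn : D ∣ n := (Finset.prod_dvd_prod_of_subset _ _ _ (Finset.filter_subset _ _)).trans
    (Nat.prod_primeFactors_dvd n)
  have hD0 : 0 < D := Nat.pos_of_dvd_of_pos hDn (Nat.pos_of_ne_zero hn0)
  have hD' : (D : ℝ) ≠ 0 := by exact_mod_cast hD0.ne'
  have ht : (D.totient : ℝ) / D = ∏ q ∈ n.primeFactors.filter (fun q => q ≤ y), (1 - (q : ℝ)⁻¹) := by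
    rw [totient_eq_mul_prod_real, mul_div_cancel_left₀ _ hD', hD, Nat.primeFactors_prod hprime]
  have hinv : ∀ q ∈ n.primeFactors, (q : ℝ)⁻¹ ≤ 1 := fun q hq =>
    inv_le_one_of_one_le₀ (by exact_mod_cast (Nat.prime_of_mem_primeFactors hq).one_le)
  set U := ∏ q ∈ n.primeFactors.filter (fun q => ¬ q ≤ y), (1 - (q : ℝ)⁻¹) with hU
  have hφ : (n.totient : ℝ) = n * ((D.totient : ℝ) / D) * U := by
    rw [ht, hU, mul_assoc, Finset.prod_filter_mul_prod_filter_not, ← totient_eq_mul_prod_real]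
  have hU1 : U ≤ 1 := Finset.prod_le_one
    (fun q hq => sub_nonneg.2 (hinv q (Finset.mem_filter.1 hq).1))
    fun q _ => sub_le_self _ (by positivity)
  have hyK : 2 ^ h ≤ y := le_trans (Nat.le_add_right _ _) hy0
  have hypos : (0 : ℝ) < y := by
    have : 0 < 2 ^ h := by positivity
    exact_mod_cast this.trans_le hyK
  have hU2 : 1 - η ≤ U := by
    refine le_trans (sub_le_sub_left ?_ 1) (Finset.one_sub_sum_le_prod_one_sub _ _
      (fun q _ => by positivity) fun q hq => hinv q (Finset.mem_filter.1 hq).1)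
    refine (Finset.sum_le_card_nsmul _ _ (y : ℝ)⁻¹ fun q hq => ?_).trans ?_
    · have : y < q := not_le.1 (Finset.mem_filter.1 hq).2
      exact inv_anti₀ hypos (by exact_mod_cast this.le)
    · rw [nsmul_eq_mul, ← div_eq_mul_inv, div_le_iff₀ hypos]
      have h5 := card_large_primeFactors_mul_le hn0 hyK hylt
      have h6 : ((n.primeFactors.filter fun q => ¬ q ≤ y).card : ℝ) * h ≤ 4 * N * y := by
        exact_mod_cast h5
      have h7 : 4 * N < h * η := by rwa [div_lt_iff₀ hη] at hh
      have hh0 : (0 : ℝ) < h := lt_trans (by positivity) hh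
      have h8 : ((n.primeFactors.filter fun q => ¬ q ≤ y).card : ℝ) * h ≤ (η * y) * h := by
        nlinarith
      exact le_of_mul_le_mul_right h8 hh0
  refine ⟨D, 4 ^ y, hDn, hD0, ?_, ?_, ?_, ?_, ?_⟩
  · refine le_trans (Finset.prod_le_prod_of_subset_of_one_le' (fun q hq => ?_) fun q hq _ => ?_)
      (primorial_le_four_pow y)
    · exact Finset.mem_filter.2 ⟨Finset.mem_range.2 (Nat.lt_succ_of_le (Finset.mem_filter.1 hq).2),
        hprime q hq⟩
    · exact (Finset.mem_filter.1 hq).2.one_le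
  · have := Nat.lt_pow_self (n := y) (a := 4) (by norm_num)
    exact ((Nat.le_add_left _ _).trans hy0).trans this.le
  · rw [← pow_mul, mul_comm, pow_mul]
    exact Nat.pow_log_le_self _ hn0
  · rw [hφ, mul_comm]
    exact mul_le_mul_of_nonneg_left hU2 (by positivity)
  · rw [hφ]
    exact mul_le_of_le_one_right (by positivity) hU1

theorem abs_card_window_sub_le {p D M R J N : ℕ} [Fact p.Prime] (hD : M * D = p - 1)
    {B : Finset (ZMod p)} (hB : ∀ x, x ∈ B ↔ x ^ M ∈ primitiveRoots D (ZMod p)) (hJ : 2 ≤ J)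
    (hsmall : D ^ R * (J ^ 2 * (1 + D ^ R * R) + R) < p) (hN : N ≤ p) {S : Finset ℕ}
    (hS : S ⊆ Finset.range N) (hSR : S.card ≤ R) :
    |((Finset.univ.filter fun x : ZMod p => ∀ i ∈ S, x + (i : ℕ) ∈ B).card : ℝ) -
      p * ((D.totient : ℝ) / D) ^ S.card| ≤ p * ((R + 2 : ℝ) / (J - 1)) + R := by
  have hp1 : 1 < p := (Fact.out : p.Prime).one_lt
  have hD0 : 0 < D := Nat.pos_of_ne_zero (by rintro rfl; omega)
  have hinj : Set.InjOn (fun i : ℕ => (i : ZMod p)) S := fun a ha b hb hab => by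
    have ha' := Finset.mem_range.1 (hS ha)
    have hb' := Finset.mem_range.1 (hS hb)
    have h := (ZMod.natCast_eq_natCast_iff' a b p).1 hab
    rwa [Nat.mod_eq_of_lt (by omega), Nat.mod_eq_of_lt (by omega)] at h
  have hcard := Finset.card_image_of_injOn hinj
  have hs : D ^ S.card * (J ^ 2 * (1 + D ^ S.card * S.card) + S.card) < p :=
    lt_of_le_of_lt (by gcongr) hsmall
  have h := abs_card_filter_shifts_sub_le hD (S.image fun i : ℕ => (i : ZMod p)) hJ
    (by rwa [hcard])
  rw [hcard] at h
  have hJ' : (0 : ℝ) < J - 1 := by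
    have : (2 : ℝ) ≤ J := by exact_mod_cast hJ
    linarith
  have hSR' : (S.card : ℝ) ≤ R := by exact_mod_cast hSR
  refine le_trans ?_ (h.trans ?_)
  · simp only [Finset.forall_mem_image, hB]
    rfl
  · gcongr

set_option maxHeartbeats 400000 in
/-- Lower bounds for the numbers of `n` with `s_n = 1` (for `b = 0`) and `s_n = 0` (for `b = 1`). -/
theorem eventually_card_seqS_ge {η : ℝ} (hη : 0 < η) (hη1 : η ≤ 1) : ∃ P : ℕ, ∀ p : ℕ,
    p.Prime → P ≤ p → ∃ t : ℝ, 0 < t ∧ t ≤ 1 ∧ 1 ≤ η * (p * t) ∧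
      ((p - 1).totient : ℝ) ≤ p * t ∧ (1 - 2 * η) * (p * t) ≤ (p - 1).totient ∧
      ∀ b ≤ 1, p * t * ((1 - t) ^ b / (2 - t)) - 9 * η * (p * t) ≤
        (((Finset.range ((p - 1).totient - 1)).filter
          fun n => seqS p n = (1 + b) % 2).card : ℝ) := by
  classical
  obtain ⟨m, c, H⟩ := exists_sum_card_gap_ge hη
  set C₀ : ℝ := 3 * (m + 4) with hC₀
  obtain ⟨K, hK⟩ := exists_nat_gt
    ((C₀ * (2 * c) ^ (m + 1) + C₀ + (2 * c + 1)) / η + (2 * m + 6))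
  obtain ⟨P, hP⟩ := exists_small_divisor_totient hη (N := 4 * m + 11) (by omega) K
  refine ⟨P + 1, fun p hp hpP => ?_⟩
  have : Fact p.Prime := ⟨hp⟩
  have hp1 := hp.one_lt
  obtain ⟨D, Y, hDn, hD0, hDY, hKY, hYn, hlow, hupp⟩ := hP (p - 1) (by omega)
  obtain ⟨M, hM⟩ := hDn
  have hMD : M * D = p - 1 := by rw [hM, mul_comm]
  set t : ℝ := (D.totient : ℝ) / D with ht
  have hD0' : (0 : ℝ) < D := by exact_mod_cast hD0
  have hDY' : (D : ℝ) ≤ Y := by exact_mod_cast hDY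
  have hY0 : (0 : ℝ) < Y := hD0'.trans_le hDY'
  have hφ1 : (1 : ℝ) ≤ D.totient := by exact_mod_cast Nat.totient_pos.2 hD0
  have hφ2 : (D.totient : ℝ) ≤ D := by exact_mod_cast Nat.totient_le D
  have ht0 : 0 < t := div_pos (by linarith) hD0'
  have ht1 : t ≤ 1 := (div_le_one hD0').2 hφ2
  have htY : 1 ≤ Y * t := by
    rw [ht, mul_div_assoc', le_div_iff₀ hD0']
    nlinarith
  have hKY' : (K : ℝ) ≤ Y := by exact_mod_cast hKY
  have hC₀0 : 0 < C₀ := by positivity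
  have hYbig : (C₀ * (2 * c) ^ (m + 1) + C₀ + (2 * c + 1)) / η + (2 * m + 6) ≤ Y :=
    hK.le.trans hKY'
  have hq0 : 0 ≤ C₀ * (2 * (c : ℝ)) ^ (m + 1) := by positivity
  have hYη : C₀ * (2 * c) ^ (m + 1) + C₀ + (2 * c + 1) ≤ η * Y := by
    rw [← div_le_iff₀' hη]
    linarith
  have hYm : 2 * m + 6 ≤ Y := by
    have : (2 * m + 6 : ℝ) ≤ Y := le_trans (le_add_of_nonneg_left (by positivity)) hYbig
    exact_mod_cast this
  have hY1 : (1 : ℝ) ≤ Y := by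
    have : 1 ≤ Y := by omega
    exact_mod_cast this
  have hp1' : ((p - 1 : ℕ) : ℝ) = p - 1 := by rw [Nat.cast_sub hp1.le, Nat.cast_one]
  have hYp : Y ^ (4 * m + 11) < p := by omega
  have hYpow : ∀ k ≤ 4 * m + 11, (Y : ℝ) ^ k ≤ p := fun k hk =>
    (pow_le_pow_right₀ hY1 hk).trans (by exact_mod_cast hYp.le)
  have hp0 : (0 : ℝ) < p := by exact_mod_cast hp.pos
  set Q : ℝ := p * t with hQ
  have hQ0 : 0 < Q := mul_pos hp0 ht0
  have hpQ : (p : ℝ) ≤ Y * Q := by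
    have := mul_le_mul_of_nonneg_left htY hp0.le
    rw [hQ]; linarith
  have hY2Q : (Y : ℝ) ^ 2 ≤ Q := by
    have h3 := (hYpow 3 (by omega)).trans hpQ
    rw [pow_succ, mul_comm] at h3
    exact le_of_mul_le_mul_left h3 hY0
  set J := Y ^ (m + 3) with hJdef
  have hJ : 2 ≤ J := le_trans (by omega : 2 ≤ Y) (Nat.le_self_pow (by omega) Y)
  have hJ' : (2 : ℝ) ≤ J := by exact_mod_cast hJ
  have hJY : (J : ℝ) = Y ^ (m + 3) := by rw [hJdef]; push_cast; rfl
  have hJ0 : (0 : ℝ) < J := by linarith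
  set e : ℝ := p * (((m + 2 : ℕ) + 2 : ℝ) / (J - 1)) + (m + 2 : ℕ) with he
  have heC : e * J ≤ C₀ * p := by
    have h1 : (J : ℝ) / (J - 1) ≤ 2 := (div_le_iff₀ (by linarith)).2 (by linarith)
    have h2 : (J : ℝ) ≤ p := hJY ▸ hYpow (m + 3) (by omega)
    have h3 : e * J = p * (m + 4) * (J / (J - 1)) + (m + 2) * J := by
      rw [he]; push_cast; ring
    rw [h3, hC₀]
    have h4 : p * (m + 4 : ℝ) * (J / (J - 1)) ≤ p * (m + 4) * 2 :=
      mul_le_mul_of_nonneg_left h1 (by positivity)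
    have h5 : (m + 2 : ℝ) * J ≤ (m + 4) * p := by gcongr; norm_num
    linarith
  have he0 : 0 ≤ e := by
    have : (0 : ℝ) < J - 1 := by linarith
    positivity
  have heY : e * Y ^ (m + 1) ≤ C₀ * Q / Y := by
    rw [le_div_iff₀ hY0]
    have h1 : e * Y ^ (m + 1) * Y * Y ≤ C₀ * Q * Y := by
      calc e * Y ^ (m + 1) * Y * Y = e * J := by rw [hJY]; ring
        _ ≤ C₀ * p := heC
        _ ≤ C₀ * (Y * Q) := by gcongr
        _ = C₀ * Q * Y := by ring
    exact le_of_mul_le_mul_right h1 hY0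
  have hdiv : ∀ a : ℝ, a ≤ η * Y → a * Q / Y ≤ η * Q := fun a ha => by
    rw [div_le_iff₀ hY0, mul_right_comm]
    exact mul_le_mul_of_nonneg_right ha hQ0.le
  have heQ : e ≤ η * Q := by
    refine le_trans ?_ (heY.trans (hdiv C₀ (by linarith [(Nat.cast_nonneg c : (0 : ℝ) ≤ c)])))
    exact le_mul_of_one_le_right he0 (one_le_pow₀ hY1)
  have hinvt : 1 / t ≤ Y := (div_le_iff₀ ht0).2 htY
  have heQ' : e * (2 * c / t) ^ (m + 1) ≤ η * Q := by
    calc e * (2 * c / t) ^ (m + 1) = (2 * c) ^ (m + 1) * (e * (1 / t) ^ (m + 1)) := by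
          rw [div_eq_mul_one_div, mul_pow]; ring
      _ ≤ (2 * c) ^ (m + 1) * (e * Y ^ (m + 1)) := by gcongr
      _ ≤ (2 * c) ^ (m + 1) * (C₀ * Q / Y) := by gcongr
      _ = (C₀ * (2 * c) ^ (m + 1)) * Q / Y := by ring
      _ ≤ η * Q := hdiv _ (by linarith [(Nat.cast_nonneg c : (0 : ℝ) ≤ c)])
  obtain ⟨L, hLc, HL⟩ := H t ht0 ht1
  have hLQ : 2 * (L : ℝ) + 1 ≤ η * Q := by
    have h1 : (L : ℝ) ≤ c * Y := by
      calc (L : ℝ) ≤ L * (Y * t) := le_mul_of_one_le_right (Nat.cast_nonneg L) htY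
        _ = L * t * Y := by ring
        _ ≤ c * Y := by gcongr
    have h2 : 2 * (L : ℝ) + 1 ≤ (2 * c + 1) * Y := by linarith
    calc 2 * (L : ℝ) + 1 ≤ (2 * c + 1) * Y := h2
      _ ≤ η * Y * Y := by gcongr; linarith
      _ = η * Y ^ 2 := by ring
      _ ≤ η * Q := by gcongr
  have hLp : 2 * L + 1 ≤ p := by
    have h1 : η * Q ≤ p := (mul_le_of_le_one_left hQ0.le hη1).trans
      (mul_le_of_le_one_right hp0.le ht1)
    have h2 := hLQ.trans h1
    exact_mod_cast h2
  have hηQ : 1 ≤ η * Q := le_trans (by linarith [(Nat.cast_nonneg L : (0 : ℝ) ≤ L)]) hLQ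
  have hsmall : D ^ (m + 2) * (J ^ 2 * (1 + D ^ (m + 2) * (m + 2)) + (m + 2)) < p := by
    have hYpos : 0 < Y := by omega
    have hYm1 : 1 ≤ Y ^ (m + 2) := Nat.one_le_pow _ _ hYpos
    calc D ^ (m + 2) * (J ^ 2 * (1 + D ^ (m + 2) * (m + 2)) + (m + 2))
        ≤ Y ^ (m + 2) * (J ^ 2 * (Y ^ (m + 2) + Y ^ (m + 2) * (m + 2)) +
          J ^ 2 * Y ^ (m + 2) * (m + 2)) := by
          gcongr
          exact Nat.le_mul_of_pos_left _ (by positivity)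
      _ = Y ^ (4 * m + 10) * (2 * m + 5) := by rw [hJdef]; ring
      _ ≤ Y ^ (4 * m + 10) * Y := by gcongr; omega
      _ < p := by rwa [← pow_succ]
  set B : Finset (ZMod p) := Finset.univ.filter fun x => x ^ M ∈ primitiveRoots D (ZMod p)
    with hBdef
  have hB : ∀ x, x ∈ B ↔ x ^ M ∈ primitiveRoots D (ZMod p) := fun x => by simp [hBdef]
  set A := primitiveRoots (p - 1) (ZMod p) with hA
  have hAB : A ⊆ B := fun x hx => by
    rw [hB, mem_primitiveRoots hD0]
    exact ((mem_primitiveRoots (by omega)).1 hx).pow (by omega) hMD.symm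
  have hcount : ∀ S : Finset ℕ, S ⊆ Finset.range (2 * L + 1) → S.card ≤ m + 2 →
      |((Finset.univ.filter fun x : ZMod p => ∀ i ∈ S, x + (i : ℕ) ∈ B).card : ℝ) -
        p * t ^ S.card| ≤ e := fun S hS hSm =>
    abs_card_window_sub_le hMD hB hJ hsmall hLp hS hSm
  have hBcard : (B.card : ℝ) ≤ Q + e := by
    have h := (abs_le.1 (hcount {0} (by simp) (by simp))).2
    simp only [Finset.mem_singleton, forall_eq, Nat.cast_zero, add_zero, Finset.card_singleton,
      pow_one, Finset.filter_univ_mem] at h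
    linarith
  have hlow' : (1 - 2 * η) * Q ≤ (p - 1).totient := by
    rw [hp1'] at hlow
    have h1 : (1 - η) * t ≤ η * Q := le_trans (by nlinarith) hηQ
    rw [hQ] at h1 ⊢
    linarith
  have hupp' : ((p - 1).totient : ℝ) ≤ Q := by
    rw [hp1'] at hupp
    rw [hQ]; linarith
  have hBA : ((B \ A).card : ℝ) ≤ 3 * η * Q := by
    rw [Finset.cast_card_sdiff hAB, hA, card_primitiveRoots_sub_one]
    linarith
  refine ⟨t, ht0, ht1, hηQ, hupp', hlow', fun b hb => ?_⟩
  have h1 := HL (fun i (x : ZMod p) => x + (i : ℕ) ∈ B) hp0.le he0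
    (fun S hS hSm => by convert hcount S hS hSm) b hb
  have h2 := (sum_card_gap_le A B L b hAB).trans
    (Nat.add_le_add_right (Nat.add_le_add_right (card_gapStarts_le _) _) _)
  have h3 : ((∑ j ∈ Finset.range L, (Finset.univ.filter fun x : ZMod p => x + (0 : ℕ) ∈ B ∧
      x + (2 * j + 1 + b : ℕ) ∈ B ∧
        ∀ i ∈ Finset.Ioo 0 (2 * j + 1 + b), ¬ x + (i : ℕ) ∈ B).card : ℕ) : ℝ) ≤ _ :=
    Nat.cast_le.2 h2
  rw [Nat.cast_sum] at h3
  have hb' : (b : ℝ) ≤ 1 := by exact_mod_cast hb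
  have h4 := h1.trans (le_trans (le_of_eq (by congr!)) h3)
  push_cast at h4
  linarith

/-- `(1 - x) / (2 - x)` is `1`-Lipschitz on `(-∞, 1]`. -/
theorem abs_one_sub_div_two_sub_sub_le {s t : ℝ} (hst : s ≤ t) (ht : t ≤ 1) :
    |(1 - t) / (2 - t) - (1 - s) / (2 - s)| ≤ t - s := by
  have h1 : 0 < 2 - t := by linarith
  have h2 : 0 < 2 - s := by linarith
  have h3 : (1 - t) / (2 - t) - (1 - s) / (2 - s) = -((t - s) / ((2 - t) * (2 - s))) := by
    field_simp
    ring
  rw [h3, abs_neg, abs_of_nonneg (div_nonneg (by linarith) (by positivity))]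
  exact div_le_self (by linarith) (by nlinarith)

theorem seqS_eq_zero_or_eq_one (p n : ℕ) : seqS p n = 0 ∨ seqS p n = 1 :=
  Nat.mod_two_eq_zero_or_one _

theorem card_seqS_eq_zero_add_card_seqS_eq_one (p N : ℕ) :
    ((Finset.range N).filter fun n => seqS p n = 0).card +
      ((Finset.range N).filter fun n => seqS p n = 1).card = N := by
  have h : ((Finset.range N).filter fun n => seqS p n = 1) =
      (Finset.range N).filter fun n => ¬ seqS p n = 0 :=
    Finset.filter_congr fun n _ => by have := seqS_eq_zero_or_eq_one p n; omega
  rw [h, Finset.card_filter_add_card_filter_not, Finset.card_range]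

/-- `N(0) = ((1 - φ(p-1)/p)/(2 - φ(p-1)/p) + o(1)) T` as `p → ∞` through the primes. -/
theorem count_zeros_asymptotic :
    ∀ ε : ℝ, 0 < ε → ∃ P : ℕ, ∀ p : ℕ, Nat.Prime p → P ≤ p →
      |((((Finset.range (Nat.totient (p - 1) - 1)).filter fun n => seqS p n = 0).card : ℝ) -
          ((Nat.totient (p - 1) - 1 : ℕ) : ℝ) *
            ((1 - (Nat.totient (p - 1) : ℝ) / (p : ℝ)) /
              (2 - (Nat.totient (p - 1) : ℝ) / (p : ℝ))))| ≤
        ε * ((Nat.totient (p - 1) - 1 : ℕ) : ℝ) := by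
  intro ε hε
  set η := min (1 / 6) (ε / 40) with hη
  have hη0 : 0 < η := by positivity
  have hη1 : η ≤ 1 / 6 := min_le_left _ _
  have hη2 : η ≤ ε / 40 := min_le_right _ _
  obtain ⟨P, hP⟩ := eventually_card_seqS_ge hη0 (by linarith)
  refine ⟨P, fun p hp hpP => ?_⟩
  obtain ⟨t, ht0, ht1, hηQ, hupp, hlow, H⟩ := hP p hp hpP
  have hsum := card_seqS_eq_zero_add_card_seqS_eq_one p ((p - 1).totient - 1)
  have hone := H 0 zero_le_one
  have hzero := H 1 le_rfl
  norm_num only [pow_zero, pow_one] at hone hzero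
  have hφ : 1 ≤ (p - 1).totient := Nat.totient_pos.2 (by have := hp.one_lt; omega)
  have hp0 : (0 : ℝ) < p := by exact_mod_cast hp.pos
  have hT : (((p - 1).totient - 1 : ℕ) : ℝ) = (p - 1).totient - 1 := by
    rw [Nat.cast_sub hφ, Nat.cast_one]
  set T := (((p - 1).totient - 1 : ℕ) : ℝ)
  set F := ((p - 1).totient : ℝ)
  set Q : ℝ := p * t with hQ
  have hsum' : (((Finset.range ((p - 1).totient - 1)).filter fun n => seqS p n = 0).card : ℝ) +
      ((Finset.range ((p - 1).totient - 1)).filter fun n => seqS p n = 1).card = T := by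
    rw [← Nat.cast_add, hsum]
  set N₀ :=
    (((Finset.range ((p - 1).totient - 1)).filter fun n => seqS p n = 0).card : ℝ)
  set N₁ :=
    (((Finset.range ((p - 1).totient - 1)).filter fun n => seqS p n = 1).card : ℝ)
  set f := (1 - t) / (2 - t) with hf
  set g := (1 - F / p) / (2 - F / p) with hg
  have h2t : 0 < 2 - t := by linarith
  have hf1 : 1 / (2 - t) = 1 - f := by
    rw [hf]; field_simp; ring
  have hFt : F / p ≤ t := (div_le_iff₀' hp0).2 hupp
  have hFt' : t - F / p ≤ 2 * η * t := by
    have h : (1 - 2 * η) * t ≤ F / p := by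
      rw [le_div_iff₀ hp0]
      linarith
    linarith
  have hfg := (abs_one_sub_div_two_sub_sub_le hFt ht1).trans hFt'
  have hQ0 : 0 < Q := mul_pos hp0 ht0
  have hf0 : 0 ≤ f := div_nonneg (by linarith) h2t.le
  have hF0 : 0 ≤ F / p := by positivity
  have hg0 : 0 ≤ g := div_nonneg (by linarith) (by linarith)
  have hg1 : g ≤ 1 := (div_le_one (by linarith)).2 (by linarith)
  have hTQ : |Q - T| ≤ 3 * η * Q := abs_le.2 ⟨by nlinarith, by linarith⟩
  have hNQ : |N₀ - Q * f| ≤ 9 * η * Q := by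
    rw [hf1] at hone
    refine abs_le.2 ⟨by linarith, by linarith⟩
  have hQfg : |Q * (f - g)| ≤ 2 * η * Q := by
    rw [abs_mul, abs_of_pos hQ0]
    have : 2 * η * t ≤ 2 * η := mul_le_of_le_one_right (by positivity) ht1
    nlinarith [hfg.trans this]
  have hTg : |(Q - T) * g| ≤ 3 * η * Q := by
    rw [abs_mul, abs_of_nonneg hg0]
    exact (mul_le_of_le_one_right (abs_nonneg _) hg1).trans hTQ
  have hQT : Q ≤ 2 * T := by
    have := (abs_le.1 hTQ).2
    nlinarith
  calc |N₀ - T * g| = |(N₀ - Q * f) + Q * (f - g) + (Q - T) * g| := by congr 1; ring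
    _ ≤ 9 * η * Q + 2 * η * Q + 3 * η * Q :=
      (abs_add_three _ _ _).trans (add_le_add_three hNQ hQfg hTg)
    _ = 14 * η * Q := by ring
    _ ≤ 14 * (ε / 40) * (2 * T) := by gcongr
    _ ≤ ε * T := by nlinarith
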